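/- arXiv:2604.02201 — 12 statements merged into one kernel-verified Lean document; each statement's English description precedes it below -/
import Mathlib

section
/- For any hidden size n > 1 and any depth L ≥ 1, the class of sequence-to-sequence functions computed by linear RNNs of hidden size n and depth L is a strict subset of the class computed by linear RNNs of hidden size n and depth L+1; that is, H^RNN_{n,L} ⊊ H^RNN_{n,L+1}. -/
open Matrix

noncomputable section

/-- Extend a finite input sequence (0-indexed: entry `t` is the paper's `x_{t+1}`)
to an infinite one by zero. -/
def extSeq {d T : ℕ} (x : Fin T → Fin d → ℝ) : ℕ → Fin d → ℝ :=
  fun t => if h : t < T then x ⟨t, h⟩ else 0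

/-- A linear RNN of input dimension `d` and hidden size `n` (with ℕ-indexed layer
parameters; a network of depth `L` only uses the parameters of layers `0,…,L-1`).
Layer `0` (the paper's layer 1) reads the `d`-dimensional input through `U0`;
layer `l ≥ 1` reads the previous layer's output through `U l`. -/
structure LinRNN (d n : ℕ) where
  h0 : ℕ → Fin n → ℝ
  U0 : Matrix (Fin n) (Fin d) ℝ
  U : ℕ → Matrix (Fin n) (Fin n) ℝ
  V : ℕ → Matrix (Fin n) (Fin n) ℝ
  b : ℕ → Fin n → ℝ

/-- `net.state x l t` is the hidden state `h_t^{(l+1)}` (layer `l` 0-indexed, time `t`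
with `t = 0` the initial state); the input at paper-time `t` is `x (t-1)`. -/
def LinRNN.state {d n : ℕ} (net : LinRNN d n) (x : ℕ → Fin d → ℝ) : ℕ → ℕ → Fin n → ℝ
  | 0, 0 => net.h0 0
  | 0, t + 1 => net.V 0 *ᵥ LinRNN.state net x 0 t + net.U0 *ᵥ x t + net.b 0
  | l + 1, 0 => net.h0 (l + 1)
  | l + 1, t + 1 =>
      net.V (l + 1) *ᵥ LinRNN.state net x (l + 1) t
        + net.U (l + 1) *ᵥ LinRNN.state net x l (t + 1) + net.b (l + 1)
  termination_by l t => (l, t)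

/-- `H^RNN_{n,L}`: the sequence-to-sequence functions (defined for every length `T`)
computed (at the last layer) by some linear RNN of hidden size `n` and depth `L`. -/
def RNNclass (d n L : ℕ) : Set ((T : ℕ) → (Fin T → Fin d → ℝ) → Fin T → Fin n → ℝ) :=
  { f | ∃ net : LinRNN d n, ∀ (T : ℕ) (x : Fin T → Fin d → ℝ) (t : Fin T),
      f T x t = net.state (extSeq x) (L - 1) ((t : ℕ) + 1) }

open Polynomial in
/-- If an invariant finite-dimensional subspace contains, for each of several distinct scalars
`μ i`, a generalized eigenvector of rank `k + 1`, then its dimension is at least `k + 1` times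
the number of these scalars. -/
theorem card_mul_succ_le_finrank_of_generalized_eigenvectors {K M ι : Type*} [Field K]
    [AddCommGroup M] [Module K M] [Fintype ι] (E : Module.End K M) (W : Submodule K M)
    [FiniteDimensional K W] (hW : ∀ w ∈ W, E w ∈ W) {μ : ι → K} (hμ : Function.Injective μ)
    (k : ℕ) {y : ι → M} (hyW : ∀ i, y i ∈ W)
    (hy : ∀ i, Module.End.HasEigenvector E (μ i) (aeval E ((X - C (μ i)) ^ k) (y i))) :
    Fintype.card ι * (k + 1) ≤ Module.finrank K W := by
  set p := (E.restrict hW).charpoly with hp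
  have hp0 : p ≠ 0 := (LinearMap.charpoly_monic _).ne_zero
  have hrestrict : ∀ (q : K[X]) (w : W), ((aeval (E.restrict hW) q w : W) : M) = aeval E q w := by
    intro q
    induction q using Polynomial.induction_on' with
    | add a b ha hb => intro w; simp [ha, hb]
    | monomial m a =>
      intro w
      simp only [aeval_monomial, Module.algebraMap_end_eq_smul_id, Module.End.mul_apply,
        LinearMap.smul_apply, LinearMap.id_apply, Submodule.coe_smul]
      congr 1
      rw [Module.End.pow_restrict m hW]
      rfl
  have hkill : ∀ i, aeval E p (y i) = 0 := by
    intro i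
    rw [← hrestrict p ⟨y i, hyW i⟩, hp, LinearMap.aeval_self_charpoly]
    simp
  have hdvd : ∀ i, (X - C (μ i)) ^ (k + 1) ∣ p := by
    intro i
    obtain ⟨q, hq, hndvd⟩ := exists_eq_pow_rootMultiplicity_mul_and_not_dvd p hp0 (μ i)
    set j := p.rootMultiplicity (μ i)
    by_contra hcon
    have hj : j ≤ k := by
      by_contra! hlt
      exact hcon (hq ▸ (pow_dvd_pow _ hlt).mul_right q)
    have hzero : aeval E (q * (X - C (μ i)) ^ k) (y i) = 0 := by
      have hfac : q * (X - C (μ i)) ^ k = (X - C (μ i)) ^ (k - j) * p := by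
        rw [hq, ← mul_assoc, ← pow_add, Nat.sub_add_cancel hj, mul_comm]
      rw [hfac, map_mul, Module.End.mul_apply, hkill, map_zero]
    rw [map_mul, Module.End.mul_apply, Module.End.aeval_apply_of_hasEigenvector (hy i)] at hzero
    exact hndvd (dvd_iff_isRoot.2 ((smul_eq_zero.1 hzero).resolve_right (hy i).2))
  have hprod : ∏ i, (X - C (μ i)) ^ (k + 1) ∣ p :=
    Finset.prod_dvd_of_coprime
      (fun i _ j _ hij => (isCoprime_X_sub_C_of_isUnit_sub
        (sub_ne_zero.2 (hμ.ne hij)).isUnit).pow) fun i _ => hdvd i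
  have hdeg := natDegree_le_of_dvd hprod hp0
  rw [LinearMap.charpoly_natDegree, natDegree_prod_of_monic _ _
    fun i _ => (monic_X_sub_C (μ i)).pow (k + 1)] at hdeg
  simpa using hdeg

/-- The left shift of real sequences. -/
def seqShift : Module.End ℝ (ℕ → ℝ) := LinearMap.funLeft ℝ ℝ Nat.succ

theorem seqShift_apply (y : ℕ → ℝ) (t : ℕ) : seqShift y t = y (t + 1) := rfl

namespace LinRNN

variable {d n : ℕ}

theorem state_zero_zero (net : LinRNN d n) (x : ℕ → Fin d → ℝ) :
    net.state x 0 0 = net.h0 0 := by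
  rw [state]

theorem state_zero_succ (net : LinRNN d n) (x : ℕ → Fin d → ℝ) (t : ℕ) :
    net.state x 0 (t + 1) = net.V 0 *ᵥ net.state x 0 t + net.U0 *ᵥ x t + net.b 0 := by
  rw [state]

theorem state_succ_zero (net : LinRNN d n) (x : ℕ → Fin d → ℝ) (l : ℕ) :
    net.state x (l + 1) 0 = net.h0 (l + 1) := by
  rw [state]

theorem state_succ_succ (net : LinRNN d n) (x : ℕ → Fin d → ℝ) (l t : ℕ) :
    net.state x (l + 1) (t + 1) = net.V (l + 1) *ᵥ net.state x (l + 1) t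
      + net.U (l + 1) *ᵥ net.state x l (t + 1) + net.b (l + 1) := by
  rw [state]

/-- The network that copies layer `L` of `net` to layer `L + 1`. -/
def copyLayer (net : LinRNN d n) (L : ℕ) : LinRNN d n where
  h0 := net.h0
  U0 := net.U0
  U := Function.update net.U (L + 1) 1
  V := Function.update net.V (L + 1) 0
  b := Function.update net.b (L + 1) 0

theorem copyLayer_state_of_le (net : LinRNN d n) (L : ℕ) (x : ℕ → Fin d → ℝ) :
    ∀ l ≤ L, ∀ t, (net.copyLayer L).state x l t = net.state x l t := by
  intro l
  induction l with
  | zero =>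
    intro _ t
    induction t with
    | zero => simp [state_zero_zero, copyLayer]
    | succ t ih => simp [state_zero_succ, ih]; simp [copyLayer]
  | succ l ihl =>
    intro hl t
    induction t with
    | zero => simp [state_succ_zero, copyLayer]
    | succ t ih =>
      rw [state_succ_succ, state_succ_succ, ih, ihl (by omega)]
      simp [copyLayer, Function.update_of_ne (show l + 1 ≠ L + 1 by omega)]

theorem copyLayer_state_succ (net : LinRNN d n) (L : ℕ) (x : ℕ → Fin d → ℝ) (t : ℕ) :
    (net.copyLayer L).state x (L + 1) (t + 1) = net.state x L (t + 1) := by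
  rw [state_succ_succ, copyLayer_state_of_le net L x L le_rfl]
  simp [copyLayer]

/-- The sequence of values taken at times `1, 2, …` by coordinate `i` of layer `l` on the
zero input. -/
def coordSeq (net : LinRNN d n) (l : ℕ) (i : Fin n) : ℕ → ℝ :=
  fun t => net.state 0 l (t + 1) i

/-- The span of the constants and of the coordinate sequences of the first `L` layers. -/
def coordSpan (net : LinRNN d n) (L : ℕ) : Submodule ℝ (ℕ → ℝ) :=
  Submodule.span ℝ (Set.range fun o : Option (Fin L × Fin n) =>
    o.elim 1 fun a => net.coordSeq a.1 a.2)

instance (net : LinRNN d n) (L : ℕ) : FiniteDimensional ℝ (net.coordSpan L) :=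
  FiniteDimensional.span_of_finite ℝ (Set.finite_range _)

theorem finrank_coordSpan_le (net : LinRNN d n) (L : ℕ) :
    Module.finrank ℝ (net.coordSpan L) ≤ L * n + 1 := by
  refine (finrank_range_le_card _).trans ?_
  simp

theorem one_mem_coordSpan (net : LinRNN d n) (L : ℕ) : (1 : ℕ → ℝ) ∈ net.coordSpan L :=
  Submodule.subset_span ⟨none, rfl⟩

theorem coordSeq_mem_coordSpan (net : LinRNN d n) {L l : ℕ} (hl : l < L) (i : Fin n) :
    net.coordSeq l i ∈ net.coordSpan L :=
  Submodule.subset_span ⟨some (⟨l, hl⟩, i), rfl⟩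

theorem seqShift_coordSeq_zero (net : LinRNN d n) (i : Fin n) :
    seqShift (net.coordSeq 0 i) = ∑ j, net.V 0 i j • net.coordSeq 0 j + net.b 0 i • 1 := by
  ext t
  simp [seqShift_apply, coordSeq, state_zero_succ net 0 (t + 1), mulVec, dotProduct]

theorem seqShift_coordSeq_succ (net : LinRNN d n) (l : ℕ) (i : Fin n) :
    seqShift (net.coordSeq (l + 1) i) = ∑ j, net.V (l + 1) i j • net.coordSeq (l + 1) j
      + ∑ j, net.U (l + 1) i j • seqShift (net.coordSeq l j) + net.b (l + 1) i • 1 := by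
  ext t
  simp [seqShift_apply, coordSeq, state_succ_succ net 0 l (t + 1), mulVec, dotProduct]

theorem seqShift_coordSeq_mem (net : LinRNN d n) {L : ℕ} (l : ℕ) :
    l < L → ∀ i, seqShift (net.coordSeq l i) ∈ net.coordSpan L := by
  induction l with
  | zero =>
    intro hl i
    rw [seqShift_coordSeq_zero]
    exact add_mem (sum_mem fun j _ => Submodule.smul_mem _ _ (net.coordSeq_mem_coordSpan hl j))
      (Submodule.smul_mem _ _ (net.one_mem_coordSpan L))
  | succ l ih =>
    intro hl i
    rw [seqShift_coordSeq_succ]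
    exact add_mem (add_mem
      (sum_mem fun j _ => Submodule.smul_mem _ _ (net.coordSeq_mem_coordSpan hl j))
      (sum_mem fun j _ => Submodule.smul_mem _ _ (ih (by omega) j)))
      (Submodule.smul_mem _ _ (net.one_mem_coordSpan L))

theorem seqShift_mem_coordSpan (net : LinRNN d n) (L : ℕ) :
    ∀ w ∈ net.coordSpan L, seqShift w ∈ net.coordSpan L := by
  intro w hw
  have hle : net.coordSpan L ≤ (net.coordSpan L).comap seqShift := by
    refine Submodule.span_le.2 ?_
    rintro _ ⟨_ | ⟨l, i⟩, rfl⟩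
    · exact net.one_mem_coordSpan L
    · exact net.seqShift_coordSeq_mem l l.2 i
  exact hle hw

/-- The network ignoring its input whose layers all have recurrent matrix `diagonal μ` and pass
on their state unchanged: coordinate `i` is a Jordan chain for the eigenvalue `μ i`. -/
def jordan (d : ℕ) (μ : Fin n → ℝ) : LinRNN d n where
  h0 := fun _ => 1
  U0 := 0
  U := fun _ => 1
  V := fun _ => diagonal μ
  b := fun _ => 0

theorem jordan_state_zero (μ : Fin n → ℝ) (x : ℕ → Fin d → ℝ) (i : Fin n) (t : ℕ) :
    (jordan d μ).state x 0 t i = μ i ^ t := by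
  induction t with
  | zero => simp [state_zero_zero, jordan]
  | succ t ih =>
    rw [state_zero_succ, pow_succ', ← ih]
    simp [jordan, mulVec_diagonal]

theorem jordan_coordSeq_zero (μ : Fin n → ℝ) (i : Fin n) (t : ℕ) :
    (jordan d μ).coordSeq 0 i t = μ i ^ (t + 1) :=
  jordan_state_zero μ 0 i (t + 1)

open Polynomial in
theorem jordan_aeval_coordSeq (μ : Fin n → ℝ) (i : Fin n) (l : ℕ) :
    aeval seqShift ((X - C (μ i)) ^ l) ((jordan d μ).coordSeq l i)
      = (seqShift ^ l) ((jordan d μ).coordSeq 0 i) := by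
  induction l with
  | zero => simp
  | succ l ih =>
    have hstep : aeval seqShift (X - C (μ i)) ((jordan d μ).coordSeq (l + 1) i)
        = aeval seqShift (X : ℝ[X]) ((jordan d μ).coordSeq l i) := by
      ext t
      simp [seqShift_apply, coordSeq, state_succ_succ (jordan d μ) 0 l (t + 1)]
      simp [jordan, mulVec_diagonal]
    rw [pow_succ, map_mul, Module.End.mul_apply, hstep, ← Module.End.mul_apply, ← map_mul,
      mul_comm, map_mul, Module.End.mul_apply, ih, aeval_X, pow_succ', Module.End.mul_apply]

open Polynomial in
theorem jordan_hasEigenvector {μ : Fin n → ℝ} {i : Fin n} (hμ : μ i ≠ 0) (l : ℕ) :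
    Module.End.HasEigenvector seqShift (μ i)
      (aeval seqShift ((X - C (μ i)) ^ l) ((jordan d μ).coordSeq l i)) := by
  have hpow : ∀ m t, (seqShift ^ m) ((jordan d μ).coordSeq 0 i) t = μ i ^ (t + 1 + m) := by
    intro m
    induction m with
    | zero => simp [jordan_coordSeq_zero]
    | succ m ih =>
      intro t
      rw [pow_succ', Module.End.mul_apply, seqShift_apply, ih]
      congr 1
      omega
  rw [jordan_aeval_coordSeq]
  refine ⟨Module.End.mem_eigenspace_iff.2 ?_, fun h => ?_⟩
  · ext t
    rw [seqShift_apply, Pi.smul_apply, hpow, hpow, smul_eq_mul, ← pow_succ']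
    congr 1
    omega
  · have h0 := congrFun h 0
    rw [hpow] at h0
    exact pow_ne_zero _ hμ h0

end LinRNN

theorem extSeq_zero (d T : ℕ) : extSeq (0 : Fin T → Fin d → ℝ) = 0 := by
  ext t i
  simp [extSeq]

/-- For any hidden size `n > 1` and depth `L ≥ 1` (and any input
dimension `d ≥ 1`), linear RNNs of depth `L` compute a strict subclass of those of
depth `L+1`: `H^RNN_{n,L} ⊊ H^RNN_{n,L+1}`. -/
theorem rnnClass_ssubset_succ_depth (d n L : ℕ) (hd : 0 < d) (hn : 1 < n) (hL : 1 ≤ L) :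
    RNNclass d n L ⊂ RNNclass d n (L + 1) := by
  obtain ⟨L, rfl⟩ : ∃ k, L = k + 1 := ⟨L - 1, by omega⟩
  refine Set.ssubset_iff_subset_ne.2 ⟨?_, fun heq => ?_⟩
  · rintro f ⟨net, hf⟩
    refine ⟨net.copyLayer L, fun T x t => ?_⟩
    rw [hf, Nat.add_sub_cancel, Nat.add_sub_cancel, net.copyLayer_state_succ]
  · set μ : Fin n → ℝ := fun i => (i : ℝ) + 1
    have hμ : Function.Injective μ := fun i j hij => by simpa [μ, Fin.ext_iff] using hij
    have hμ0 : ∀ i, μ i ≠ 0 := fun i => by positivity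
    have hmem : (fun T (x : Fin T → Fin d → ℝ) (t : Fin T) =>
        (LinRNN.jordan d μ).state (extSeq x) (L + 1) ((t : ℕ) + 1)) ∈
        RNNclass d n (L + 1 + 1) := ⟨LinRNN.jordan d μ, fun _ _ _ => rfl⟩
    rw [← heq] at hmem
    obtain ⟨net, hnet⟩ := hmem
    have hseq : ∀ i, (LinRNN.jordan d μ).coordSeq (L + 1) i = net.coordSeq L i := by
      intro i
      ext t
      have h := congrFun (hnet (t + 1) 0 (Fin.last t)) i
      simpa [extSeq_zero, LinRNN.coordSeq] using h
    have hcard := card_mul_succ_le_finrank_of_generalized_eigenvectors seqShift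
      (net.coordSpan (L + 1)) (net.seqShift_mem_coordSpan (L + 1)) hμ (L + 1)
      (y := (LinRNN.jordan d μ).coordSeq (L + 1))
      (fun i => hseq i ▸ net.coordSeq_mem_coordSpan (Nat.lt_succ_self L) i)
      (fun i => LinRNN.jordan_hasEigenvector (hμ0 i) (L + 1))
    have hle := hcard.trans (net.finrank_coordSpan_le (L + 1))
    rw [Fintype.card_fin] at hle
    nlinarith

end
end

section
/- For any hidden size n > 1 and any integer p ≥ 1, there exist a linear RNN of hidden size n and depth L = ⌈p/(n−1)⌉ and a linear map w : ℝ^n → ℝ such that for every input sequence x_1,…,x_T ∈ ℝ^d and every time step t ≤ T, w(h_t^(L)) = f_p(x_1,…,x_t). -/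
open Matrix

noncomputable section

/-- The copy function `f_p`: at (paper) time `t` (here the 0-indexed `t : Fin T`,
paper time `t+1`) it returns the first component of the input `p` steps earlier,
and `0` if that time is not positive. -/
def fp {d : ℕ} (hd : 0 < d) (p : ℕ) {T : ℕ} (x : Fin T → Fin d → ℝ) (t : Fin T) : ℝ :=
  if p ≤ (t : ℕ) then x ⟨(t : ℕ) - p, lt_of_le_of_lt (Nat.sub_le _ _) t.isLt⟩ ⟨0, hd⟩ else 0

/-- The scalar sequence `u` delayed by `k` steps: its value at paper-time `t`, where `u t`
is read at paper-time `t + 1`, with zeros before the start of the sequence. -/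
def delay (u : ℕ → ℝ) (k t : ℕ) : ℝ :=
  if k < t then u (t - 1 - k) else 0

lemma delay_zero_right (u : ℕ → ℝ) (k : ℕ) : delay u k 0 = 0 := by
  simp [delay]

lemma delay_zero_succ (u : ℕ → ℝ) (t : ℕ) : delay u 0 (t + 1) = u t := by
  simp [delay]

lemma delay_succ_succ (u : ℕ → ℝ) (k t : ℕ) : delay u (k + 1) (t + 1) = delay u k t := by
  simp only [delay, Nat.add_lt_add_iff_right]
  congr 2
  omega

/-- The matrix of the down-shift of coordinates. -/
def shiftMatrix (n : ℕ) : Matrix (Fin n) (Fin n) ℝ :=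
  Matrix.of fun i j => if (j : ℕ) + 1 = i then 1 else 0

/-- The matrix whose only nonzero entry is a `1` in row `0` and column `k`. -/
def feedMatrix (n m k : ℕ) : Matrix (Fin n) (Fin m) ℝ :=
  Matrix.of fun i j => if (i : ℕ) = 0 ∧ (j : ℕ) = k then 1 else 0

lemma shiftMatrix_mulVec_zero {n : ℕ} (v : Fin n → ℝ) (i : Fin n) (hi : (i : ℕ) = 0) :
    (shiftMatrix n *ᵥ v) i = 0 := by
  simp [shiftMatrix, Matrix.mulVec, dotProduct, hi]

lemma shiftMatrix_mulVec_succ {n : ℕ} (v : Fin n → ℝ) (i j : Fin n) (hij : (j : ℕ) + 1 = i) :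
    (shiftMatrix n *ᵥ v) i = v j := by
  have h (a : Fin n) : (a : ℕ) + 1 = i ↔ a = j := by
    rw [Fin.ext_iff]; omega
  simp [shiftMatrix, Matrix.mulVec, dotProduct, h]

lemma feedMatrix_mulVec_zero {n m : ℕ} (v : Fin m → ℝ) (k : Fin m) (i : Fin n)
    (hi : (i : ℕ) = 0) : (feedMatrix n m k *ᵥ v) i = v k := by
  simp [feedMatrix, Matrix.mulVec, dotProduct, hi, ← Fin.ext_iff]

lemma feedMatrix_mulVec_of_ne {n m : ℕ} (v : Fin m → ℝ) (k : ℕ) (i : Fin n)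
    (hi : (i : ℕ) ≠ 0) : (feedMatrix n m k *ᵥ v) i = 0 := by
  simp [feedMatrix, Matrix.mulVec, dotProduct, hi]

/-- The linear RNN each of whose layers is a shift register of length `n` fed by the last
register of the layer below. -/
def shiftRNN (d n : ℕ) : LinRNN d n where
  h0 _ := 0
  U0 := feedMatrix n d 0
  U _ := feedMatrix n n (n - 1)
  V _ := shiftMatrix n
  b _ := 0

/-- A shift register fed with the sequence delayed by `c` holds the successive delays. -/
lemma eq_delay_of_shift {n : ℕ} (u : ℕ → ℝ) (c : ℕ) (s f : ℕ → Fin n → ℝ) (h0 : s 0 = 0)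
    (hs : ∀ t, s (t + 1) = shiftMatrix n *ᵥ s t + f t)
    (hf : ∀ t (i : Fin n), f t i = if (i : ℕ) = 0 then delay u c (t + 1) else 0)
    (t : ℕ) (i : Fin n) : s t i = delay u (c + i) t := by
  induction t generalizing i with
  | zero => simp [h0, delay_zero_right]
  | succ t ih =>
    rw [hs, Pi.add_apply, hf]
    by_cases hi : (i : ℕ) = 0
    · simp [shiftMatrix_mulVec_zero _ _ hi, hi]
    · have hj : (i : ℕ) - 1 + 1 = i := by omega
      rw [shiftMatrix_mulVec_succ _ i ⟨(i : ℕ) - 1, by omega⟩ hj, ih, if_neg hi, add_zero,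
        ← delay_succ_succ, add_assoc, hj]

lemma shiftRNN_state {d n : ℕ} (hd : 0 < d) (hn : 0 < n) (x : ℕ → Fin d → ℝ) (l t : ℕ)
    (i : Fin n) :
    (shiftRNN d n).state x l t i = delay (fun s => x s ⟨0, hd⟩) (l * (n - 1) + i) t := by
  induction l generalizing t i with
  | zero =>
    refine eq_delay_of_shift _ _ _ (fun t => feedMatrix n d 0 *ᵥ x t) ?_ (fun t => ?_)
      (fun t i => ?_) t i
    · simp [LinRNN.state, shiftRNN]
    · rw [LinRNN.state]
      simp [shiftRNN]
    · split_ifs with hi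
      · rw [zero_mul, delay_zero_succ]
        exact feedMatrix_mulVec_zero (x t) ⟨0, hd⟩ i hi
      · exact feedMatrix_mulVec_of_ne _ _ _ hi
  | succ l ih =>
    refine eq_delay_of_shift _ _ _
      (fun t => feedMatrix n n (n - 1) *ᵥ (shiftRNN d n).state x l (t + 1)) ?_ (fun t => ?_)
      (fun t i => ?_) t i
    · simp [LinRNN.state, shiftRNN]
    · rw [LinRNN.state]
      simp [shiftRNN]
    · split_ifs with hi
      · rw [Nat.succ_mul]
        exact (feedMatrix_mulVec_zero _ ⟨n - 1, by omega⟩ i hi).trans (ih _ _)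
      · exact feedMatrix_mulVec_of_ne _ _ _ hi

lemma delay_extSeq {d T : ℕ} (hd : 0 < d) (p : ℕ) (x : Fin T → Fin d → ℝ) (t : Fin T) :
    delay (fun s => extSeq x s ⟨0, hd⟩) p (t + 1) = fp hd p x t := by
  have h : (t : ℕ) - p < T := by omega
  simp [delay, fp, extSeq, h]

/-- For any `n > 1` and `p ≥ 1`, there is a linear RNN of hidden size
`n` and depth `L = ⌈p/(n-1)⌉` (so last-layer index `⌈p/(n-1)⌉ - 1`, with
`⌈p/(n-1)⌉ = (p + n - 2)/(n-1)` in ℕ) and a linear map `w : ℝ^n → ℝ` such that for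
every input sequence and every time step, `w(h_t^{(L)}) = f_p(x_1,…,x_t)`. -/
theorem exists_rnn_computing_fp (d n p : ℕ) (hd : 0 < d) (hn : 1 < n) (hp : 1 ≤ p) :
    ∃ (net : LinRNN d n) (w : (Fin n → ℝ) →ₗ[ℝ] ℝ),
      ∀ (T : ℕ) (x : Fin T → Fin d → ℝ) (t : Fin T),
        w (net.state (extSeq x) ((p + n - 2) / (n - 1) - 1) ((t : ℕ) + 1)) = fp hd p x t := by
  have hdiv : (p + n - 2) / (n - 1) - 1 = (p - 1) / (n - 1) := by
    rw [show p + n - 2 = p - 1 + (n - 1) by omega, Nat.add_div_right _ (by omega)]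
    rfl
  have hmod : (p - 1) % (n - 1) + 1 < n := by
    have := Nat.mod_lt (p - 1) (show 0 < n - 1 by omega)
    omega
  have hsum : (p - 1) / (n - 1) * (n - 1) + ((p - 1) % (n - 1) + 1) = p := by
    have := Nat.div_add_mod' (p - 1) (n - 1)
    omega
  refine ⟨shiftRNN d n, LinearMap.proj ⟨(p - 1) % (n - 1) + 1, hmod⟩, fun T x t => ?_⟩
  rw [LinearMap.proj_apply, hdiv, shiftRNN_state hd (by omega), hsum, delay_extSeq]

end
end

section
/- For any n > 1 and L ≥ 2, the class H^∥_{n,L} of functions mapping an input sequence to the sequence of concatenations over all L layers of the hidden states of a linear RNN of hidden size n and depth L is a strict subset of H^RNN_{nL,1}, the class of functions computed by single-layer linear RNNs of hidden size nL. -/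
open Matrix

noncomputable section

/-- `H^∥_{n,L}`: the functions mapping every input sequence to the sequence of
concatenations (over all `L` layers) of the hidden states of some linear RNN of
hidden size `n` and depth `L`; a coordinate `k : Fin (n * L)` decodes (via
`finProdFinEquiv`) into a within-layer index in `Fin n` and a layer index in `Fin L`. -/
def RNNconcatClass (d n L : ℕ) :
    Set ((T : ℕ) → (Fin T → Fin d → ℝ) → Fin T → Fin (n * L) → ℝ) :=
  { f | ∃ net : LinRNN d n, ∀ (T : ℕ) (x : Fin T → Fin d → ℝ) (t : Fin T) (k : Fin (n * L)),
      f T x t k =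
        net.state (extSeq x) ((finProdFinEquiv.symm k).2 : ℕ) ((t : ℕ) + 1)
          (finProdFinEquiv.symm k).1 }

/-- The state at time `t` of all layers, concatenated. -/
def LinRNN.concatState {d n : ℕ} (net : LinRNN d n) (L : ℕ) (x : ℕ → Fin d → ℝ) (t : ℕ) :
    Fin (n * L) → ℝ :=
  fun k => net.state x ((finProdFinEquiv.symm k).2 : ℕ) t (finProdFinEquiv.symm k).1

/-- The matrix extracting the block of layer `l` from a concatenated state. -/
def layerProjection (n : ℕ) {L : ℕ} (l : Fin L) : Matrix (Fin n) (Fin (n * L)) ℝ :=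
  Matrix.of fun i => Pi.single (finProdFinEquiv (i, l)) 1

/-- The states of a single layer are a linear image of the concatenated states. -/
lemma LinRNN.state_eq_mulVec_concatState {d n : ℕ} (net : LinRNN d n) {L l : ℕ} (hl : l < L)
    (x : ℕ → Fin d → ℝ) (t : ℕ) :
    net.state x l t = layerProjection n ⟨l, hl⟩ *ᵥ net.concatState L x t := by
  ext i
  simp [layerProjection, Matrix.mulVec, LinRNN.concatState]

/-- Each layer is updated affinely in the previous concatenated state and the input. -/
lemma LinRNN.exists_affine_update {d n : ℕ} (net : LinRNN d n) (L l : ℕ) (hl : l < L) :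
    ∃ (A : Matrix (Fin n) (Fin (n * L)) ℝ) (B : Matrix (Fin n) (Fin d) ℝ) (c : Fin n → ℝ),
      ∀ x t, net.state x l (t + 1) = A *ᵥ net.concatState L x t + B *ᵥ x t + c := by
  induction l with
  | zero =>
    refine ⟨net.V 0 * layerProjection n ⟨0, hl⟩, net.U0, net.b 0, fun x t => ?_⟩
    rw [LinRNN.state, net.state_eq_mulVec_concatState hl, Matrix.mulVec_mulVec]
  | succ l ih =>
    obtain ⟨A, B, c, h⟩ := ih (by omega)
    refine ⟨net.V (l + 1) * layerProjection n ⟨l + 1, hl⟩ + net.U (l + 1) * A, net.U (l + 1) * B,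
      net.U (l + 1) *ᵥ c + net.b (l + 1), fun x t => ?_⟩
    rw [LinRNN.state, h, net.state_eq_mulVec_concatState hl, Matrix.add_mulVec,
      Matrix.mulVec_add, Matrix.mulVec_add, Matrix.mulVec_mulVec, Matrix.mulVec_mulVec,
      Matrix.mulVec_mulVec]
    abel

/-- The concatenated states of a deep linear RNN are the states of a single-layer one. -/
lemma RNNconcatClass_subset_RNNclass (d n L : ℕ) :
    RNNconcatClass d n L ⊆ RNNclass d (n * L) 1 := by
  rintro f ⟨net, hf⟩
  choose A B c h using fun l : Fin L => net.exists_affine_update L l l.2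
  let shallow : LinRNN d (n * L) :=
    { h0 := fun _ => net.concatState L 0 0
      U0 := Matrix.of fun k => B (finProdFinEquiv.symm k).2 (finProdFinEquiv.symm k).1
      U := 0
      V := fun _ => Matrix.of fun k => A (finProdFinEquiv.symm k).2 (finProdFinEquiv.symm k).1
      b := fun _ k => c (finProdFinEquiv.symm k).2 (finProdFinEquiv.symm k).1 }
  have hstate : ∀ x t, shallow.state x 0 t = net.concatState L x t := by
    intro x t
    induction t with
    | zero =>
      rw [LinRNN.state]
      ext k
      simp only [shallow, LinRNN.concatState]
      cases ((finProdFinEquiv.symm k).2 : ℕ) <;> simp [LinRNN.state]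
    | succ t ih =>
      rw [LinRNN.state, ih]
      ext k
      exact (congrFun (h (finProdFinEquiv.symm k).2 x t) (finProdFinEquiv.symm k).1).symm
  refine ⟨shallow, fun T x t => ?_⟩
  ext k
  rw [hf, hstate]
  rfl

/-- Some single-layer linear RNN is not the concatenation of the layers of a deep one: a
coordinate of the first block may recall the previous input through the second block, whereas
the first layer of a deep network evolves independently of the others. -/
lemma not_RNNclass_subset_RNNconcatClass {d n L : ℕ} (hd : 0 < d) (hn : 0 < n) (hL : 2 ≤ L) :
    ¬ RNNclass d (n * L) 1 ⊆ RNNconcatClass d n L := by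
  intro hsub
  let e (i : Fin n) : Fin (n * L) := finProdFinEquiv (i, (⟨0, by omega⟩ : Fin L))
  let p : Fin (n * L) := finProdFinEquiv ((⟨0, hn⟩ : Fin n), (⟨1, hL⟩ : Fin L))
  let j : Fin d := ⟨0, hd⟩
  let shallow : LinRNN d (n * L) :=
    { h0 := 0
      U0 := Matrix.single p j 1
      U := 0
      V := fun _ => Matrix.single (e ⟨0, hn⟩) p 1
      b := 0 }
  obtain ⟨net, hnet⟩ := hsub (show (fun T x (t : Fin T) => shallow.state (extSeq x) 0 ((t : ℕ) + 1)) ∈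
    RNNclass d (n * L) 1 from ⟨shallow, fun _ _ _ => rfl⟩)
  have hep : ∀ i, e i ≠ p := fun i h => by simp [e, p] at h
  have key : ∀ (x : Fin 2 → Fin d → ℝ) (t : Fin 2) (i : Fin n),
      net.state (extSeq x) 0 ((t : ℕ) + 1) i =
        shallow.state (extSeq x) 0 ((t : ℕ) + 1) (e i) := fun x t i => by
    simpa [e] using (hnet 2 x t (e i)).symm
  have first : ∀ x : Fin 2 → Fin d → ℝ, net.state (extSeq x) 0 1 = 0 := fun x => by
    ext i
    have h := key x 0 i
    simp only [Fin.val_zero, zero_add] at h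
    rw [h]
    simp [LinRNN.state, shallow, Matrix.single_mulVec, Function.update_of_ne (hep i)]
  have second : ∀ a : ℝ, net.state (extSeq ![Pi.single j a, 0]) 0 2 ⟨0, hn⟩ = a := fun a => by
    have h := key ![Pi.single j a, 0] 1 ⟨0, hn⟩
    simp only [Fin.val_one, Nat.reduceAdd] at h
    rw [h]
    simp [LinRNN.state, shallow, Matrix.single_mulVec, extSeq]
  have h0 := second 0
  have h1 := second 1
  rw [LinRNN.state, first] at h0 h1
  simp [extSeq] at h0 h1
  linarith

/-- For any `n > 1` and `L ≥ 2` (and input dimension `d ≥ 1`), the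
class `H^∥_{n,L}` of concatenated hidden-state sequence functions of depth-`L` linear
RNNs of hidden size `n` is a strict subset of `H^RNN_{nL,1}`, the class computed by
single-layer linear RNNs of hidden size `nL`. -/
theorem concatClass_ssubset_shallow (d n L : ℕ) (hd : 0 < d) (hn : 1 < n) (hL : 2 ≤ L) :
    RNNconcatClass d n L ⊂ RNNclass d (n * L) 1 := by
  exact ⟨RNNconcatClass_subset_RNNclass d n L,
    not_RNNclass_subset_RNNconcatClass hd (by omega) hL⟩

end
end

section
/- Define #params(n,L) = (2L−1)n² + (L+1)n. For all integers n ≥ 4, L̃ and L with 1 ≤ L̃ < L, and every integer ñ satisfying ñ ≥ (L/L̃)(n−1) + 1, it holds that #params(ñ, L̃) > #params(n, L). -/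
/-- Number of parameters of an `L`-layer linear RNN with hidden size `n` and input
dimension `1`: `#params(n,L) = (2L-1)n² + (L+1)n`. -/
def nparams (n L : ℕ) : ℕ := (2 * L - 1) * n ^ 2 + (L + 1) * n

/-- For all integers `n ≥ 4`, `1 ≤ L̃ < L`, and every integer `ñ` with
`ñ ≥ (L/L̃)(n-1) + 1` (an inequality over the reals), one has
`#params(ñ, L̃) > #params(n, L)`. -/
theorem nparams_shallow_gt (n Lt L nt : ℕ) (hn : 4 ≤ n) (hLt : 1 ≤ Lt) (hLtL : Lt < L)
    (hnt : ((L : ℝ) / (Lt : ℝ)) * ((n : ℝ) - 1) + 1 ≤ (nt : ℝ)) :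
    nparams n L < nparams nt Lt := by
  have hx (k l : ℕ) (hl : 1 ≤ l) :
      (nparams k l : ℝ) = (2 * l - 1) * (k : ℝ) ^ 2 + (l + 1) * k := by
    have h : 1 ≤ 2 * l := by omega
    simp [nparams, Nat.cast_sub h]
  rw [← Nat.cast_lt (α := ℝ), hx n L (by omega), hx nt Lt hLt]
  have hn' : (4 : ℝ) ≤ n := by exact_mod_cast hn
  have ha : (1 : ℝ) ≤ Lt := by exact_mod_cast hLt
  have hL : (Lt : ℝ) + 1 ≤ L := by exact_mod_cast hLtL
  generalize (n : ℝ) = N at *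
  generalize (nt : ℝ) = x at *
  generalize (Lt : ℝ) = a at *
  generalize (L : ℝ) = b at *
  obtain ⟨m, rfl⟩ : ∃ m, N = m + 1 := ⟨N - 1, by ring⟩
  obtain ⟨r, rfl⟩ : ∃ r, b = r * a := ⟨b / a, by field_simp⟩
  have ha0 : 0 < a := by linarith
  rw [mul_div_cancel_right₀ _ ha0.ne', add_sub_cancel_right] at hnt
  have hm : 3 ≤ m := by linarith
  have hr : 1 < r := by nlinarith
  have hra : r ≤ r * a := by nlinarith
  have hy : 0 ≤ r * m + 1 := by nlinarith
  have hmono : (2 * a - 1) * (r * m + 1) ^ 2 + (a + 1) * (r * m + 1)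
      ≤ (2 * a - 1) * x ^ 2 + (a + 1) * x := by
    have : 0 ≤ 2 * a - 1 := by linarith
    gcongr
  refine lt_of_lt_of_le ?_ hmono
  have hcoef : m ^ 2 * a ≤ m ^ 2 * (2 * (r * a) - r - 1) := by
    gcongr
    linarith
  have hquad : 0 < m ^ 2 * (2 * (r * a) - r - 1) - m - 3 * a := by
    nlinarith [mul_nonneg (sub_nonneg.2 hm) ha0.le,
      mul_nonneg (mul_nonneg (sub_nonneg.2 hm) ha0.le) (by linarith : 0 ≤ m),
      mul_nonneg (sub_nonneg.2 ha) (by linarith : 0 ≤ m)]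
  linear_combination mul_pos (sub_pos.2 hr) hquad
end

section
/- For all integers L̃ and L with 1 ≤ L̃ < L, the quantity ã = 2LL̃ − L − L̃ is strictly positive, and 1 + L̃(1 + √(12ã + 1))/(2ã) ≤ (3 + √13)/2 < 4. -/
/-- For all integers `1 ≤ L̃ < L`, the quantity `ã = 2LL̃ − L − L̃` is
strictly positive, and the largest root `1 + L̃(1 + √(12ã + 1))/(2ã)` of the associated
quadratic is at most `(3 + √13)/2`, which is less than `4`. -/
theorem critical_root_le (Lt L : ℕ) (hLt : 1 ≤ Lt) (hLtL : Lt < L) :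
    (0 : ℝ) < 2 * (L : ℝ) * (Lt : ℝ) - (L : ℝ) - (Lt : ℝ) ∧
    1 + (Lt : ℝ) * (1 + Real.sqrt (12 * (2 * (L : ℝ) * (Lt : ℝ) - (L : ℝ) - (Lt : ℝ)) + 1)) /
        (2 * (2 * (L : ℝ) * (Lt : ℝ) - (L : ℝ) - (Lt : ℝ))) ≤ (3 + Real.sqrt 13) / 2 ∧
    (3 + Real.sqrt 13) / 2 < 4 := by
  have ht : (1 : ℝ) ≤ Lt := by exact_mod_cast hLt
  have hL : (Lt : ℝ) + 1 ≤ L := by exact_mod_cast hLtL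
  have hsq : (Lt : ℝ) ^ 2 ≤ 2 * (L : ℝ) * (Lt : ℝ) - (L : ℝ) - (Lt : ℝ) := by
    nlinarith [mul_nonneg (sub_nonneg.2 hL) (by linarith : (0 : ℝ) ≤ 2 * (Lt : ℝ) - 1)]
  generalize 2 * (L : ℝ) * (Lt : ℝ) - (L : ℝ) - (Lt : ℝ) = a at hsq ⊢
  generalize (Lt : ℝ) = t at *
  have hta : t ≤ a := by nlinarith
  have ha : 0 < a := by linarith
  have h13 : Real.sqrt 13 ^ 2 = 13 := Real.sq_sqrt (by norm_num)
  have key : t * Real.sqrt (12 * a + 1) ≤ Real.sqrt 13 * a := by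
    rw [← pow_le_pow_iff_left₀ (by positivity) (by positivity) two_ne_zero, mul_pow, mul_pow,
      h13, Real.sq_sqrt (by positivity)]
    calc t ^ 2 * (12 * a + 1) ≤ a * (12 * a + 1) := by gcongr
      _ ≤ 13 * a ^ 2 := by nlinarith
  refine ⟨ha, ?_, ?_⟩
  · have hdiv : t * (1 + Real.sqrt (12 * a + 1)) / (2 * a) ≤ (1 + Real.sqrt 13) / 2 := by
      rw [div_le_iff₀ (by positivity)]
      linarith
    linarith
  · have : Real.sqrt 13 < 5 := by
      rw [Real.sqrt_lt' (by norm_num)]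
      norm_num
    linarith
end

section
/- Let h be the function computed by a linear BIRNN of hidden size n and depth L. Then for every sequence length T, the map ℝ^{dT} → ℝ^{nT} sending the concatenated inputs (x_1,…,x_T) to the concatenated last-layer hidden states (h_1^(L),…,h_T^(L)) is a polynomial map (each coordinate of the output is a multivariate polynomial in the coordinates of the inputs) of total degree at most T^L. -/
open Matrix

noncomputable section

/-- A linear BIRNN of input dimension `d` and hidden size `n` (ℕ-indexed layer
parameters; a network of depth `L` only uses layers `0,…,L-1`). Layer `0` (the
paper's layer 1) has tensor `A0 : ℝ^{n×d×n}`; layer `l ≥ 1` has tensor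
`A l : ℝ^{n×n×n}`, with entries indexed as `A i j k = A_{i,j,k}`. -/
structure BIRNN (d n : ℕ) where
  h0 : ℕ → Fin n → ℝ
  A0 : Fin n → Fin d → Fin n → ℝ
  A : ℕ → Fin n → Fin n → Fin n → ℝ

/-- `net.state x l t` is the hidden state `h_t^{(l+1)}` (layer `l` 0-indexed, time `t`
with `t = 0` the initial state), computed via
`(h_t^{(l)})_k = Σ_{i,j} A^{(l)}_{i,j,k} (h_{t-1}^{(l)})_i (h_t^{(l-1)})_j`. -/
def BIRNN.state {d n : ℕ} (net : BIRNN d n) (x : ℕ → Fin d → ℝ) : ℕ → ℕ → Fin n → ℝ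
  | 0, 0 => net.h0 0
  | 0, t + 1 => fun k => ∑ i, ∑ j, net.A0 i j k * BIRNN.state net x 0 t i * x t j
  | l + 1, 0 => net.h0 (l + 1)
  | l + 1, t + 1 => fun k =>
      ∑ i, ∑ j, net.A (l + 1) i j k * BIRNN.state net x (l + 1) t i
        * BIRNN.state net x l (t + 1) j
  termination_by l t => (l, t)

/-- A real function `f` on vectors indexed by `σ` is given by a multivariate polynomial of total
degree at most `N`. -/
def IsPolynomialOfDegreeLE {σ : Type*} (f : (σ → ℝ) → ℝ) (N : ℕ) : Prop :=
  ∃ p : MvPolynomial σ ℝ, p.totalDegree ≤ N ∧ ∀ x, MvPolynomial.eval x p = f x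

namespace IsPolynomialOfDegreeLE

variable {σ : Type*} {f g : (σ → ℝ) → ℝ} {M N : ℕ}

theorem mono (hf : IsPolynomialOfDegreeLE f M) (h : M ≤ N) : IsPolynomialOfDegreeLE f N :=
  let ⟨p, hp, hpf⟩ := hf
  ⟨p, hp.trans h, hpf⟩

theorem const (c : ℝ) (N : ℕ) : IsPolynomialOfDegreeLE (fun _ : σ → ℝ => c) N :=
  ⟨MvPolynomial.C c, by simp, by simp⟩

theorem coord (i : σ) : IsPolynomialOfDegreeLE (fun x : σ → ℝ => x i) 1 :=
  ⟨MvPolynomial.X i, by simp, by simp⟩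

theorem mul (hf : IsPolynomialOfDegreeLE f M) (hg : IsPolynomialOfDegreeLE g N) :
    IsPolynomialOfDegreeLE (fun x => f x * g x) (M + N) := by
  obtain ⟨p, hp, hpf⟩ := hf
  obtain ⟨q, hq, hqg⟩ := hg
  exact ⟨p * q, (MvPolynomial.totalDegree_mul p q).trans (add_le_add hp hq),
    fun x => by rw [map_mul, hpf, hqg]⟩

theorem const_mul (c : ℝ) (hf : IsPolynomialOfDegreeLE f N) :
    IsPolynomialOfDegreeLE (fun x => c * f x) N := by
  simpa using (const c 0).mul hf

theorem sum {ι : Type*} (s : Finset ι) {F : ι → (σ → ℝ) → ℝ}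
    (hF : ∀ i, IsPolynomialOfDegreeLE (F i) N) :
    IsPolynomialOfDegreeLE (fun x => ∑ i ∈ s, F i x) N := by
  choose p hp hpF using hF
  exact ⟨∑ i ∈ s, p i, MvPolynomial.totalDegree_finsetSum_le fun i _ => hp i,
    fun x => by simp [hpF]⟩

theorem bilinear {m n : ℕ} (a : Fin m → Fin n → ℝ) {u : (σ → ℝ) → Fin m → ℝ}
    {v : (σ → ℝ) → Fin n → ℝ} (hu : ∀ i, IsPolynomialOfDegreeLE (fun x => u x i) M)
    (hv : ∀ j, IsPolynomialOfDegreeLE (fun x => v x j) N) :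
    IsPolynomialOfDegreeLE (fun x => ∑ i, ∑ j, a i j * u x i * v x j) (M + N) :=
  sum _ fun i => sum _ fun j => ((hu i).const_mul (a i j)).mul (hv j)

end IsPolynomialOfDegreeLE

theorem isPolynomialOfDegreeLE_extSeq {d T : ℕ} (t : ℕ) (j : Fin d) :
    IsPolynomialOfDegreeLE
      (fun x : Fin T × Fin d → ℝ => extSeq (fun s i => x (s, i)) t j) 1 := by
  by_cases h : t < T
  · simpa [extSeq, h] using IsPolynomialOfDegreeLE.coord (σ := Fin T × Fin d) (⟨t, h⟩, j)
  · simpa [extSeq, h] using IsPolynomialOfDegreeLE.const (σ := Fin T × Fin d) 0 1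

theorem BIRNN.isPolynomialOfDegreeLE_state {d n T : ℕ} (net : BIRNN d n) (l t : ℕ) (k : Fin n) :
    IsPolynomialOfDegreeLE
      (fun x : Fin T × Fin d → ℝ => net.state (extSeq fun s i => x (s, i)) l t k)
      (t ^ (l + 1)) := by
  induction l generalizing t k with
  | zero =>
    induction t generalizing k with
    | zero => simpa only [BIRNN.state] using .const _ _
    | succ t ih =>
      simp only [BIRNN.state]
      exact (IsPolynomialOfDegreeLE.bilinear (fun i j => net.A0 i j k) ih
        (isPolynomialOfDegreeLE_extSeq t)).mono (by simp)
  | succ l ihl =>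
    induction t generalizing k with
    | zero => simpa only [BIRNN.state] using .const _ _
    | succ t ih =>
      simp only [BIRNN.state]
      refine (IsPolynomialOfDegreeLE.bilinear (fun i j => net.A (l + 1) i j k) ih
        (ihl (t + 1))).mono ?_
      calc t ^ (l + 1 + 1) + (t + 1) ^ (l + 1)
          = t ^ (l + 1) * t + (t + 1) ^ (l + 1) := by rw [pow_succ]
        _ ≤ (t + 1) ^ (l + 1) * t + (t + 1) ^ (l + 1) := by gcongr; omega
        _ = (t + 1) ^ (l + 1 + 1) := by ring

/-- For any linear BIRNN of hidden size `n` and depth `L` and any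
sequence length `T`, the map sending the inputs `(x_1,…,x_T)` to the last-layer
hidden states `(h_1^{(L)},…,h_T^{(L)})` is a polynomial map: each coordinate of the
output is given by a multivariate polynomial in the `T·d` input coordinates, of total
degree at most `T^L`. -/
theorem birnn_polynomial_of_degree_le (d n L : ℕ) (hL : 1 ≤ L) (net : BIRNN d n) (T : ℕ) :
    ∃ P : Fin T → Fin n → MvPolynomial (Fin T × Fin d) ℝ,
      (∀ (t : Fin T) (k : Fin n), (P t k).totalDegree ≤ T ^ L) ∧
      ∀ (x : Fin T → Fin d → ℝ) (t : Fin T) (k : Fin n),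
        MvPolynomial.eval (fun q : Fin T × Fin d => x q.1 q.2) (P t k)
          = net.state (extSeq x) (L - 1) ((t : ℕ) + 1) k := by
  choose P hP hPeval using fun (t : Fin T) (k : Fin n) =>
    net.isPolynomialOfDegreeLE_state (T := T) (L - 1) ((t : ℕ) + 1) k
  refine ⟨P, fun t k => (hP t k).trans ?_, fun x t k => hPeval t k _⟩
  rw [Nat.sub_add_cancel hL]
  exact Nat.pow_le_pow_left t.isLt L

end
end

section
/- For any linear BIRNN of hidden size n and depth L and any inputs x_1, x_2 ∈ ℝ^d, each coordinate of the second-time-step hidden state h_2^(L) is a polynomial function of the coordinates of (x_1, x_2) whose degree in the coordinates of x_1 is at most L. More precisely, for every layer l, h_1^(l) is a linear function of x_1, and h_2^(l) = (∏_{i=l}^{1} (A^(i) ×_1 h_1^(i))ᵀ) x_2, so h_2^(l) has degree at most l in x_1. -/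
open Matrix

noncomputable section

/-- The length-two input sequence `(x₁, x₂)` (0-indexed), extended by zero. -/
def twoSeq {d : ℕ} (x1 x2 : Fin d → ℝ) : ℕ → Fin d → ℝ :=
  fun t => if t = 0 then x1 else if t = 1 then x2 else 0

/-- `(A^{(l)} ×₁ h₁^{(l)})ᵀ` for a layer `l ≥ 1` (0-indexed): the `n × n` matrix with
entries `(k,j) ↦ Σ_i A^{(l)}_{i,j,k} (h₁^{(l)})_i`. -/
def BIRNN.Umat {d n : ℕ} (net : BIRNN d n) (x : ℕ → Fin d → ℝ) (l : ℕ) :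
    Matrix (Fin n) (Fin n) ℝ :=
  Matrix.of fun k j => ∑ i, net.A l i j k * net.state x l 1 i

/-- `(A^{(1)} ×₁ h₁^{(1)})ᵀ` for the first layer: the `n × d` matrix with
entries `(k,j) ↦ Σ_i A^{(1)}_{i,j,k} (h₁^{(1)})_i`. -/
def BIRNN.Umat0 {d n : ℕ} (net : BIRNN d n) (x : ℕ → Fin d → ℝ) :
    Matrix (Fin n) (Fin d) ℝ :=
  Matrix.of fun k j => ∑ i, net.A0 i j k * net.state x 0 1 i

/-- The ordered product `∏_{i=l}^{1} (A^{(i)} ×₁ h₁^{(i)})ᵀ` (larger layer index on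
the left), 0-indexed: `prodMat x m = Umat x m * ⋯ * Umat x 1 * Umat0 x`. -/
def BIRNN.prodMat {d n : ℕ} (net : BIRNN d n) (x : ℕ → Fin d → ℝ) :
    ℕ → Matrix (Fin n) (Fin d) ℝ
  | 0 => net.Umat0 x
  | m + 1 => net.Umat x (m + 1) * net.prodMat x m

open MvPolynomial in
/-- The polynomials in two families of variables whose degree in the first family is at
most `k`. -/
def MvPolynomial.inlDegreeLE (R σ τ : Type*) [CommSemiring R] [Fintype σ] (k : ℕ) :
    Submodule R (MvPolynomial (σ ⊕ τ) R) :=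
  restrictSupport R {m | ∑ j, m (Sum.inl j) ≤ k}

namespace MvPolynomial

variable {R σ τ : Type*} [CommSemiring R] [Fintype σ]

open scoped Pointwise in
theorem mul_mem_inlDegreeLE {p q : MvPolynomial (σ ⊕ τ) R} {a b : ℕ}
    (hp : p ∈ inlDegreeLE R σ τ a) (hq : q ∈ inlDegreeLE R σ τ b) :
    p * q ∈ inlDegreeLE R σ τ (a + b) := by
  have h := Submodule.mul_mem_mul hp hq
  rw [inlDegreeLE, inlDegreeLE, ← restrictSupport_add] at h
  refine restrictSupport_mono R ?_ h
  rintro _ ⟨m, hm, m', hm', rfl⟩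
  simpa [Finset.sum_add_distrib] using add_le_add hm hm'

theorem X_inl_mem_inlDegreeLE (j : σ) :
    (X (Sum.inl j) : MvPolynomial (σ ⊕ τ) R) ∈ inlDegreeLE R σ τ 1 := by
  classical
  refine (monomial_mem_restrictSupport R).2 (Or.inl ?_)
  simp [Finsupp.single_apply]

theorem X_inr_mem_inlDegreeLE (j : τ) :
    (X (Sum.inr j) : MvPolynomial (σ ⊕ τ) R) ∈ inlDegreeLE R σ τ 0 := by
  refine (monomial_mem_restrictSupport R).2 (Or.inl ?_)
  simp

end MvPolynomial

namespace BIRNN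

variable {d n : ℕ} (net : BIRNN d n)

theorem exists_state_one_eq_mulVec (m : ℕ) :
    ∃ M : Matrix (Fin n) (Fin d) ℝ, ∀ x : ℕ → Fin d → ℝ, net.state x m 1 = M *ᵥ x 0 := by
  induction m with
  | zero =>
    refine ⟨Matrix.of fun k j => ∑ i, net.A0 i j k * net.h0 0 i, fun x => ?_⟩
    ext k
    simp only [state, mulVec, dotProduct, of_apply, Finset.sum_mul]
    exact Finset.sum_comm
  | succ m ih =>
    obtain ⟨M, hM⟩ := ih
    refine ⟨(Matrix.of fun k j => ∑ i, net.A (m + 1) i j k * net.h0 (m + 1) i) * M,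
      fun x => ?_⟩
    rw [← mulVec_mulVec, ← hM x]
    ext k
    rw [state]
    simp only [state.eq_3, mulVec, dotProduct, of_apply, Finset.sum_mul, zero_add]
    exact Finset.sum_comm

theorem state_two_eq_prodMat_mulVec (x : ℕ → Fin d → ℝ) (m : ℕ) :
    net.state x m 2 = net.prodMat x m *ᵥ x 1 := by
  induction m with
  | zero =>
    ext k
    rw [state, prodMat]
    simp only [Umat0, mulVec, dotProduct, of_apply, Finset.sum_mul]
    exact Finset.sum_comm
  | succ m ih =>
    rw [prodMat, ← mulVec_mulVec, ← ih]
    ext k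
    rw [state]
    simp only [Umat, mulVec, dotProduct, of_apply, Finset.sum_mul]
    exact Finset.sum_comm

open MvPolynomial

theorem exists_eval_eq_state_one (m : ℕ) :
    ∃ Q : Fin n → MvPolynomial (Fin d ⊕ Fin d) ℝ,
      (∀ i, Q i ∈ inlDegreeLE ℝ (Fin d) (Fin d) 1) ∧
      ∀ (x : ℕ → Fin d → ℝ) (i : Fin n),
        eval (Sum.elim (x 0) (x 1)) (Q i) = net.state x m 1 i := by
  obtain ⟨M, hM⟩ := net.exists_state_one_eq_mulVec m
  refine ⟨fun i => ∑ j, M i j • X (Sum.inl j), fun i => Submodule.sum_mem _ fun j _ =>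
    Submodule.smul_mem _ _ (X_inl_mem_inlDegreeLE j), fun x i => ?_⟩
  simp [hM, mulVec, dotProduct, smul_eval]

theorem exists_eval_eq_state_two (m : ℕ) :
    ∃ P : Fin n → MvPolynomial (Fin d ⊕ Fin d) ℝ,
      (∀ k, P k ∈ inlDegreeLE ℝ (Fin d) (Fin d) (m + 1)) ∧
      ∀ (x : ℕ → Fin d → ℝ) (k : Fin n),
        eval (Sum.elim (x 0) (x 1)) (P k) = net.state x m 2 k := by
  induction m with
  | zero =>
    obtain ⟨Q, hQ, hQx⟩ := net.exists_eval_eq_state_one 0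
    refine ⟨fun k => ∑ i, ∑ j, net.A0 i j k • (Q i * X (Sum.inr j)), fun k =>
      Submodule.sum_mem _ fun i _ => Submodule.sum_mem _ fun j _ => Submodule.smul_mem _ _ <|
        mul_mem_inlDegreeLE (a := 1) (b := 0) (hQ i) (X_inr_mem_inlDegreeLE j),
      fun x k => ?_⟩
    rw [state]
    simp [hQx, smul_eval, mul_assoc]
  | succ m ih =>
    obtain ⟨P, hP, hPx⟩ := ih
    obtain ⟨Q, hQ, hQx⟩ := net.exists_eval_eq_state_one (m + 1)
    refine ⟨fun k => ∑ i, ∑ j, net.A (m + 1) i j k • (P j * Q i), fun k =>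
      Submodule.sum_mem _ fun i _ => Submodule.sum_mem _ fun j _ => Submodule.smul_mem _ _ <|
        mul_mem_inlDegreeLE (hP j) (hQ i), fun x k => ?_⟩
    rw [state]
    simp [hPx, hQx, smul_eval, mul_assoc, mul_comm (net.state x m 2 _)]

end BIRNN

/-- For any linear BIRNN of hidden size `n` and depth `L` and any
inputs `x₁, x₂ ∈ ℝ^d`, for every layer `l` (0-indexed `m = l - 1 < L`):
(i) `h₁^{(l)}` is a linear function of `x₁`;
(ii) `h₂^{(l)} = (∏_{i=l}^{1} (A^{(i)} ×₁ h₁^{(i)})ᵀ) x₂`;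
(iii) each coordinate of `h₂^{(l)}` is a polynomial in the coordinates of `(x₁, x₂)`
whose degree in the coordinates of `x₁` is at most `l = m + 1`. -/
theorem birnn_second_step_poly_degree (d n L : ℕ) (hL : 1 ≤ L) (net : BIRNN d n) :
    (∀ m < L, ∃ M : Matrix (Fin n) (Fin d) ℝ, ∀ x1 x2 : Fin d → ℝ,
        net.state (twoSeq x1 x2) m 1 = M *ᵥ x1) ∧
    (∀ m < L, ∀ x1 x2 : Fin d → ℝ,
        net.state (twoSeq x1 x2) m 2 = net.prodMat (twoSeq x1 x2) m *ᵥ x2) ∧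
    (∀ m < L, ∃ P : Fin n → MvPolynomial (Fin d ⊕ Fin d) ℝ,
        (∀ k : Fin n, ∀ mono ∈ (P k).support, (∑ j : Fin d, mono (Sum.inl j)) ≤ m + 1) ∧
        ∀ (x1 x2 : Fin d → ℝ) (k : Fin n),
          MvPolynomial.eval (Sum.elim x1 x2) (P k) = net.state (twoSeq x1 x2) m 2 k) := by
  refine ⟨fun m _ => ?_, fun m _ x1 x2 => net.state_two_eq_prodMat_mulVec (twoSeq x1 x2) m,
    fun m _ => ?_⟩
  · obtain ⟨M, hM⟩ := net.exists_state_one_eq_mulVec m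
    exact ⟨M, fun x1 x2 => hM (twoSeq x1 x2)⟩
  · obtain ⟨P, hP, hPx⟩ := net.exists_eval_eq_state_two m
    exact ⟨P, fun k _ hmono => hP k hmono, fun x1 x2 => hPx (twoSeq x1 x2)⟩

end
end

section
/- Consider the linear BIRNN with d = n, tensors A^(l)_{i,j,k} = δ_{i,j,k} (equal to 1 if i = j = k and 0 otherwise), and initial states h0^(l) = (1,…,1)ᵀ for all layers l = 1,…,L. Then for every layer l, h_1^(l) = x_1 and h_2^(l) = diag(x_1)^l x_2; in particular h_2^(L) = diag(x_1)^L x_2, a polynomial of degree exactly L in the coordinates of x_1. -/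
open Matrix

noncomputable section

/-- Contraction with the delta tensor is the coordinatewise product. -/
theorem sum_delta_mul {n : ℕ} (B : Fin n → Fin n → Fin n → ℝ)
    (hB : ∀ i j k, B i j k = if i = j ∧ j = k then 1 else 0) (u v : Fin n → ℝ) :
    (fun k => ∑ i, ∑ j, B i j k * u i * v j) = u * v := by
  funext k
  simp [hB, ite_and]

/-- Consider the linear BIRNN with `d = n`, tensors
`A^{(l)}_{i,j,k} = δ_{i,j,k}` and initial states `h0^{(l)} = (1,…,1)ᵀ` for all layers
`l = 1,…,L` (0-indexed `0,…,L-1`). Then for every layer, `h₁^{(l)} = x₁` and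
`h₂^{(l)} = diag(x₁)^l x₂`; in particular `h₂^{(L)} = diag(x₁)^L x₂`, i.e.
coordinatewise `(h₂^{(L)})_k = (x₁)_k^L (x₂)_k`, a polynomial of degree exactly `L`
in the coordinates of `x₁`. -/
theorem birnn_delta_construction (n L : ℕ) (hn : 1 ≤ n) (hL : 1 ≤ L) (net : BIRNN n n)
    (hA0 : ∀ i j k, net.A0 i j k = if i = j ∧ j = k then 1 else 0)
    (hA : ∀ l, 1 ≤ l → l < L → ∀ i j k, net.A l i j k = if i = j ∧ j = k then 1 else 0)
    (hh0 : ∀ l < L, net.h0 l = fun _ => 1)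
    (x1 x2 : Fin n → ℝ) :
    (∀ m < L, net.state (twoSeq x1 x2) m 1 = x1) ∧
    (∀ m < L, net.state (twoSeq x1 x2) m 2 = (Matrix.diagonal x1) ^ (m + 1) *ᵥ x2) ∧
    net.state (twoSeq x1 x2) (L - 1) 2 = (Matrix.diagonal x1) ^ L *ᵥ x2 ∧
    ∀ k, net.state (twoSeq x1 x2) (L - 1) 2 k = x1 k ^ L * x2 k := by
  have first : ∀ m < L, net.state (twoSeq x1 x2) m 1 = x1 := by
    intro m hm
    induction m with
    | zero =>
      rw [BIRNN.state, sum_delta_mul _ hA0, BIRNN.state, hh0 0 hm]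
      funext k
      simp [twoSeq]
    | succ m ih =>
      rw [BIRNN.state, sum_delta_mul _ (hA (m + 1) (by omega) hm), BIRNN.state, hh0 _ hm,
        zero_add, ih (by omega)]
      funext k
      simp
  have second : ∀ m < L, net.state (twoSeq x1 x2) m 2 = fun k => x1 k ^ (m + 1) * x2 k := by
    intro m hm
    induction m with
    | zero =>
      rw [BIRNN.state, sum_delta_mul _ hA0, first 0 hm]
      funext k
      simp [twoSeq]
    | succ m ih =>
      rw [BIRNN.state, sum_delta_mul _ (hA (m + 1) (by omega) hm), first _ hm,
        one_add_one_eq_two, ih (by omega)]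
      funext k
      simp only [Pi.mul_apply]
      ring
  have diag_pow : ∀ p : ℕ, diagonal x1 ^ p *ᵥ x2 = fun k => x1 k ^ p * x2 k := by
    intro p
    funext k
    simp [diagonal_pow, mulVec_diagonal]
  have last : net.state (twoSeq x1 x2) (L - 1) 2 = fun k => x1 k ^ L * x2 k := by
    rw [second _ (by omega), Nat.sub_add_cancel hL]
  exact ⟨first, fun m hm => by rw [second m hm, diag_pow], by rw [last, diag_pow],
    fun k => by rw [last]⟩

end
end

section
/- For any hidden size n > 1 and any depth L ≥ 1, the class of sequence-to-sequence functions computed by linear 2RNNs of hidden size n and depth L is a strict subset of the class computed by linear 2RNNs of hidden size n and depth L+1; that is, H^2RNN_{n,L} ⊊ H^2RNN_{n,L+1}. -/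
open Matrix

noncomputable section

/-- A linear (identity-activation) second-order RNN (2RNN) of input dimension `d` and
hidden size `n` (ℕ-indexed layer parameters; a network of depth `L` only uses layers
`0,…,L-1`). Layer `0` (the paper's layer 1) has tensor `A0 : ℝ^{n×d×n}` and input
matrix `U0 : ℝ^{n×d}`; layer `l ≥ 1` has tensor `A l : ℝ^{n×n×n}` and matrix `U l`. -/
structure SORNN (d n : ℕ) where
  h0 : ℕ → Fin n → ℝ
  A0 : Fin n → Fin d → Fin n → ℝ
  A : ℕ → Fin n → Fin n → Fin n → ℝ
  U0 : Matrix (Fin n) (Fin d) ℝ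
  U : ℕ → Matrix (Fin n) (Fin n) ℝ
  V : ℕ → Matrix (Fin n) (Fin n) ℝ
  b : ℕ → Fin n → ℝ

/-- `net.state x l t` is the hidden state `h_t^{(l+1)}` (layer `l` 0-indexed, time `t`
with `t = 0` the initial state), computed via
`h_t^{(l)} = A^{(l)} ×₁ h_{t-1}^{(l)} ×₂ h_t^{(l-1)} + V^{(l)} h_{t-1}^{(l)} + U^{(l)} h_t^{(l-1)} + b^{(l)}`. -/
def SORNN.state {d n : ℕ} (net : SORNN d n) (x : ℕ → Fin d → ℝ) : ℕ → ℕ → Fin n → ℝ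
  | 0, 0 => net.h0 0
  | 0, t + 1 =>
      (fun k => ∑ i, ∑ j, net.A0 i j k * SORNN.state net x 0 t i * x t j)
        + net.V 0 *ᵥ SORNN.state net x 0 t + net.U0 *ᵥ x t + net.b 0
  | l + 1, 0 => net.h0 (l + 1)
  | l + 1, t + 1 =>
      (fun k => ∑ i, ∑ j, net.A (l + 1) i j k * SORNN.state net x (l + 1) t i
          * SORNN.state net x l (t + 1) j)
        + net.V (l + 1) *ᵥ SORNN.state net x (l + 1) t
        + net.U (l + 1) *ᵥ SORNN.state net x l (t + 1) + net.b (l + 1)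
  termination_by l t => (l, t)

/-- `H^2RNN_{n,L}`: the sequence-to-sequence functions (defined for every length `T`)
computed at the last layer by some linear 2RNN of hidden size `n` and depth `L`. -/
def SORNNclass (d n L : ℕ) : Set ((T : ℕ) → (Fin T → Fin d → ℝ) → Fin T → Fin n → ℝ) :=
  { f | ∃ net : SORNN d n, ∀ (T : ℕ) (x : Fin T → Fin d → ℝ) (t : Fin T),
      f T x t = net.state (extSeq x) (L - 1) ((t : ℕ) + 1) }

/-- `f` is a real polynomial function of degree at most `a`. -/
def IsPolyOfDegreeLE (a : ℕ) (f : ℝ → ℝ) : Prop :=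
  ∃ p : Polynomial ℝ, p.natDegree ≤ a ∧ ∀ s, f s = p.eval s

namespace IsPolyOfDegreeLE

theorem const (a : ℕ) (c : ℝ) : IsPolyOfDegreeLE a fun _ => c :=
  ⟨Polynomial.C c, by simp, by simp⟩

theorem id : IsPolyOfDegreeLE 1 fun s => s :=
  ⟨Polynomial.X, by simp, by simp⟩

theorem mono {a b : ℕ} {f : ℝ → ℝ} (hf : IsPolyOfDegreeLE a f) (h : a ≤ b) :
    IsPolyOfDegreeLE b f :=
  let ⟨p, hp, hpf⟩ := hf
  ⟨p, hp.trans h, hpf⟩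

theorem add {a : ℕ} {f g : ℝ → ℝ} (hf : IsPolyOfDegreeLE a f) (hg : IsPolyOfDegreeLE a g) :
    IsPolyOfDegreeLE a fun s => f s + g s := by
  obtain ⟨p, hp, hpf⟩ := hf
  obtain ⟨q, hq, hqg⟩ := hg
  exact ⟨p + q, Polynomial.natDegree_add_le_of_degree_le hp hq, by simp [hpf, hqg]⟩

theorem mul {a b : ℕ} {f g : ℝ → ℝ} (hf : IsPolyOfDegreeLE a f) (hg : IsPolyOfDegreeLE b g) :
    IsPolyOfDegreeLE (a + b) fun s => f s * g s := by
  obtain ⟨p, hp, hpf⟩ := hf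
  obtain ⟨q, hq, hqg⟩ := hg
  exact ⟨p * q, Polynomial.natDegree_mul_le_of_le hp hq, by simp [hpf, hqg]⟩

theorem const_mul {a : ℕ} {f : ℝ → ℝ} (c : ℝ) (hf : IsPolyOfDegreeLE a f) :
    IsPolyOfDegreeLE a fun s => c * f s :=
  ((const 0 c).mul hf).mono (by omega)

theorem sum {ι : Type*} {a : ℕ} (t : Finset ι) {f : ι → ℝ → ℝ}
    (hf : ∀ i, IsPolyOfDegreeLE a (f i)) : IsPolyOfDegreeLE a fun s => ∑ i ∈ t, f i s := by
  classical
  induction t using Finset.induction_on with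
  | empty => simpa using const a 0
  | insert i t hi ih => simpa [Finset.sum_insert hi] using (hf i).add ih

/-- The degree of a second-order update is at most the sum of the degrees of its arguments. -/
theorem secondOrderUpdate {m n a b : ℕ} {u : ℝ → Fin n → ℝ} {v : ℝ → Fin m → ℝ}
    (hu : ∀ i, IsPolyOfDegreeLE a fun s => u s i) (hv : ∀ j, IsPolyOfDegreeLE b fun s => v s j)
    (A : Fin n → Fin m → Fin n → ℝ) (V : Matrix (Fin n) (Fin n) ℝ)
    (U : Matrix (Fin n) (Fin m) ℝ) (c : Fin n → ℝ) (k : Fin n) :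
    IsPolyOfDegreeLE (a + b) fun s =>
      ((fun k => ∑ i, ∑ j, A i j k * u s i * v s j) + V *ᵥ u s + U *ᵥ v s + c) k := by
  simp only [Pi.add_apply, Matrix.mulVec, dotProduct]
  refine (((sum _ fun i => sum _ fun j => ((hu i).const_mul _).mul (hv j)).add ?_).add ?_).add
    (const _ _)
  · exact sum _ fun i => ((hu i).const_mul _).mono (by omega)
  · exact sum _ fun j => ((hv j).const_mul _).mono (by omega)

end IsPolyOfDegreeLE

/-- The input sequence of length two whose entries are constantly `s`, respectively `1`. -/
def powerInput (d : ℕ) (s : ℝ) : Fin 2 → Fin d → ℝ :=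
  ![fun _ => s, fun _ => 1]

@[simp]
theorem extSeq_powerInput_zero (d : ℕ) (s : ℝ) : extSeq (powerInput d s) 0 = fun _ => s := by
  simp [extSeq, powerInput]

@[simp]
theorem extSeq_powerInput_one (d : ℕ) (s : ℝ) : extSeq (powerInput d s) 1 = fun _ => 1 := by
  simp [extSeq, powerInput]

namespace SORNN

variable {d n : ℕ}

theorem isPolyOfDegreeLE_state_one (net : SORNN d n) (l : ℕ) (k : Fin n) :
    IsPolyOfDegreeLE 1 fun s => net.state (extSeq (powerInput d s)) l 1 k := by
  induction l generalizing k with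
  | zero =>
    have h := IsPolyOfDegreeLE.secondOrderUpdate (a := 0) (b := 1) (u := fun _ => net.h0 0)
      (v := fun s (_ : Fin d) => s) (fun _ => .const _ _) (fun _ => .id)
      net.A0 (net.V 0) net.U0 (net.b 0) k
    convert h using 2 with s
    rw [state, state, extSeq_powerInput_zero]
  | succ l ih =>
    have h := IsPolyOfDegreeLE.secondOrderUpdate (a := 0) (b := 1)
      (u := fun _ => net.h0 (l + 1)) (fun _ => .const _ _) ih
      (net.A (l + 1)) (net.V (l + 1)) (net.U (l + 1)) (net.b (l + 1)) k
    convert h using 2 with s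
    rw [state, state]

theorem isPolyOfDegreeLE_state_two (net : SORNN d n) (l : ℕ) (k : Fin n) :
    IsPolyOfDegreeLE (l + 1) fun s => net.state (extSeq (powerInput d s)) l 2 k := by
  induction l generalizing k with
  | zero =>
    have h := IsPolyOfDegreeLE.secondOrderUpdate (a := 1) (b := 0)
      (v := fun _ (_ : Fin d) => 1) (net.isPolyOfDegreeLE_state_one 0) (fun _ => .const _ _)
      net.A0 (net.V 0) net.U0 (net.b 0) k
    convert h using 2 with s
    rw [state, extSeq_powerInput_one]
  | succ l ih =>
    have h := IsPolyOfDegreeLE.secondOrderUpdate (net.isPolyOfDegreeLE_state_one (l + 1)) ih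
      (net.A (l + 1)) (net.V (l + 1)) (net.U (l + 1)) (net.b (l + 1)) k
    rw [add_comm]
    convert h using 2 with s
    rw [state]

/-- The network whose layers up to `m` are those of `net` and whose layer `m + 1` copies
layer `m`. -/
def appendIdentity (net : SORNN d n) (m : ℕ) : SORNN d n where
  h0 := net.h0
  A0 := net.A0
  A l := if l ≤ m then net.A l else 0
  U0 := net.U0
  U l := if l ≤ m then net.U l else 1
  V l := if l ≤ m then net.V l else 0
  b l := if l ≤ m then net.b l else 0

theorem state_appendIdentity_of_le (net : SORNN d n) (m : ℕ) (x : ℕ → Fin d → ℝ) {l : ℕ}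
    (hl : l ≤ m) (t : ℕ) : (net.appendIdentity m).state x l t = net.state x l t := by
  induction l generalizing t with
  | zero =>
    induction t with
    | zero => simp [state, appendIdentity]
    | succ t ih =>
      rw [state, state, ih]
      simp [appendIdentity]
  | succ l ihl =>
    induction t with
    | zero => simp [state, appendIdentity]
    | succ t ih =>
      rw [state, state, ih, ihl (by omega)]
      simp [appendIdentity, hl]

theorem state_appendIdentity (net : SORNN d n) (m : ℕ) (x : ℕ → Fin d → ℝ) (t : ℕ) :
    (net.appendIdentity m).state x (m + 1) (t + 1) = net.state x m (t + 1) := by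
  rw [state, state_appendIdentity_of_le net m x le_rfl]
  ext k
  simp [appendIdentity]

end SORNN

/-- The network all of whose layers multiply coordinatewise their previous state by their input
(by the first entry of the input for the first layer), starting from the all-ones state. -/
def productNet (d n : ℕ) (hd : 0 < d) : SORNN d n where
  h0 _ _ := 1
  A0 i j k := if i = k then if j = ⟨0, hd⟩ then 1 else 0 else 0
  A _ i j k := if i = k then if j = k then 1 else 0 else 0
  U0 := 0
  U _ := 0
  V _ := 0
  b _ := 0

theorem productNet_state_zero_succ {d n : ℕ} (hd : 0 < d) (x : ℕ → Fin d → ℝ) (t : ℕ)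
    (k : Fin n) : (productNet d n hd).state x 0 (t + 1) k =
      (productNet d n hd).state x 0 t k * x t ⟨0, hd⟩ := by
  rw [SORNN.state]
  simp [productNet, ite_mul]

theorem productNet_state_succ_succ {d n : ℕ} (hd : 0 < d) (x : ℕ → Fin d → ℝ) (l t : ℕ)
    (k : Fin n) : (productNet d n hd).state x (l + 1) (t + 1) k =
      (productNet d n hd).state x (l + 1) t k * (productNet d n hd).state x l (t + 1) k := by
  rw [SORNN.state]
  simp [productNet, ite_mul]

theorem productNet_state_one {d n : ℕ} (hd : 0 < d) (l : ℕ) (s : ℝ) (k : Fin n) :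
    (productNet d n hd).state (extSeq (powerInput d s)) l 1 k = s := by
  induction l with
  | zero =>
    rw [productNet_state_zero_succ, SORNN.state]
    simp [productNet]
  | succ l ih =>
    rw [productNet_state_succ_succ, ih, SORNN.state]
    simp [productNet]

theorem productNet_state_two {d n : ℕ} (hd : 0 < d) (l : ℕ) (s : ℝ) (k : Fin n) :
    (productNet d n hd).state (extSeq (powerInput d s)) l 2 k = s ^ (l + 1) := by
  induction l with
  | zero => simp [productNet_state_zero_succ hd _ 1, productNet_state_one]
  | succ l ih => rw [productNet_state_succ_succ hd, ih, productNet_state_one, ← pow_succ']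

/-- For any hidden size `n > 1` and depth `L ≥ 1` (and input
dimension `d ≥ 1`), linear 2RNNs of depth `L` compute a strict subclass of those of
depth `L+1`: `H^2RNN_{n,L} ⊊ H^2RNN_{n,L+1}`. -/
theorem sornnClass_ssubset_succ_depth (d n L : ℕ) (hd : 0 < d) (hn : 1 < n) (hL : 1 ≤ L) :
    SORNNclass d n L ⊂ SORNNclass d n (L + 1) := by
  obtain ⟨m, rfl⟩ : ∃ m, L = m + 1 := ⟨L - 1, by omega⟩
  rw [Set.ssubset_iff_subset_ne]
  refine ⟨?_, fun h => ?_⟩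
  · rintro f ⟨net, hf⟩
    refine ⟨net.appendIdentity m, fun T x t => ?_⟩
    rw [hf]
    exact (net.state_appendIdentity m (extSeq x) t).symm
  · have hmem : (fun (T : ℕ) (x : Fin T → Fin d → ℝ) (t : Fin T) =>
        (productNet d n hd).state (extSeq x) (m + 1) ((t : ℕ) + 1)) ∈
        SORNNclass d n (m + 1 + 1) := ⟨productNet d n hd, fun _ _ _ => rfl⟩
    rw [← h] at hmem
    obtain ⟨net, hnet⟩ := hmem
    let k : Fin n := ⟨0, by omega⟩
    obtain ⟨p, hp, hps⟩ := net.isPolyOfDegreeLE_state_two (d := d) m k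
    have hpow (s : ℝ) : s ^ (m + 2) = p.eval s := by
      rw [← hps s, ← productNet_state_two hd (m + 1) s k]
      exact congrFun (hnet 2 (powerInput d s) 1) k
    have hpX : p = Polynomial.X ^ (m + 2) :=
      Polynomial.funext fun s => by simp [hpow s]
    rw [hpX, Polynomial.natDegree_X_pow] at hp
    omega

end
end

section
/- For any hidden size n > 1, any depth L ≥ 1 and any rank R with 1 ≤ R < n, the class of sequence-to-sequence functions computed by linear CPBIRNNs of hidden size n, depth L and rank R is a strict subset of the class computed by linear CPBIRNNs of hidden size n, depth L and rank R+1; that is, H^CPBIRNN_{n,L,R} ⊊ H^CPBIRNN_{n,L,R+1}. -/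
open Matrix

noncomputable section

/-- A linear CPBIRNN of input dimension `d`, hidden size `n` and rank `R`
(ℕ-indexed layer parameters; a network of depth `L` only uses layers `0,…,L-1`).
Layer `0` (the paper's layer 1) has factor matrix `B0 : ℝ^{d×R}`; every layer `l`
has factors `A l, C l : ℝ^{n×R}` and, for `l ≥ 1`, `B l : ℝ^{n×R}`. -/
structure CPBIRNN (d n R : ℕ) where
  h0 : ℕ → Fin n → ℝ
  A : ℕ → Matrix (Fin n) (Fin R) ℝ
  B0 : Matrix (Fin d) (Fin R) ℝ
  B : ℕ → Matrix (Fin n) (Fin R) ℝ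
  C : ℕ → Matrix (Fin n) (Fin R) ℝ

/-- `net.state x l t` is the hidden state `h_t^{(l+1)}` (layer `l` 0-indexed, time `t`
with `t = 0` the initial state), computed via
`h_t^{(l)} = C^{(l)} diag(A^{(l)ᵀ} h_{t-1}^{(l)}) B^{(l)ᵀ} h_t^{(l-1)}`. -/
def CPBIRNN.state {d n R : ℕ} (net : CPBIRNN d n R) (x : ℕ → Fin d → ℝ) :
    ℕ → ℕ → Fin n → ℝ
  | 0, 0 => net.h0 0
  | 0, t + 1 =>
      (net.C 0 * Matrix.diagonal ((net.A 0)ᵀ *ᵥ CPBIRNN.state net x 0 t) * (net.B0)ᵀ) *ᵥ x t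
  | l + 1, 0 => net.h0 (l + 1)
  | l + 1, t + 1 =>
      (net.C (l + 1) * Matrix.diagonal ((net.A (l + 1))ᵀ *ᵥ CPBIRNN.state net x (l + 1) t)
          * (net.B (l + 1))ᵀ) *ᵥ CPBIRNN.state net x l (t + 1)
  termination_by l t => (l, t)

/-- `H^CPBIRNN_{n,L,R}`: the sequence-to-sequence functions (defined for every length
`T`) computed at the last layer by some linear CPBIRNN of hidden size `n`, depth `L`
and rank `R`. -/
def CPBIRNNclass (d n L R : ℕ) :
    Set ((T : ℕ) → (Fin T → Fin d → ℝ) → Fin T → Fin n → ℝ) :=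
  { f | ∃ net : CPBIRNN d n R, ∀ (T : ℕ) (x : Fin T → Fin d → ℝ) (t : Fin T),
      f T x t = net.state (extSeq x) (L - 1) ((t : ℕ) + 1) }

/-- A bilinear recurrent layer, written coordinatewise. -/
theorem mul_diagonal_mul_transpose_mulVec_apply {m n R : ℕ} (C : Matrix (Fin n) (Fin R) ℝ)
    (v : Fin R → ℝ) (B : Matrix (Fin m) (Fin R) ℝ) (x : Fin m → ℝ) (i : Fin n) :
    ((C * Matrix.diagonal v * Bᵀ) *ᵥ x) i = ∑ r, C i r * (v r * (Bᵀ *ᵥ x) r) := by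
  rw [← Matrix.mulVec_mulVec, ← Matrix.mulVec_mulVec]
  simp [Matrix.mulVec, dotProduct, Matrix.diagonal_apply]

/-- Append a zero column to a matrix. -/
def appendZeroCol {m R : ℕ} (M : Matrix (Fin m) (Fin R) ℝ) : Matrix (Fin m) (Fin (R + 1)) ℝ :=
  Matrix.of fun i => Fin.snoc (α := fun _ => ℝ) (M i) 0

theorem appendZeroCol_layer {m n R : ℕ} (C A : Matrix (Fin n) (Fin R) ℝ)
    (B : Matrix (Fin m) (Fin R) ℝ) (h : Fin n → ℝ) (x : Fin m → ℝ) :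
    (appendZeroCol C * Matrix.diagonal ((appendZeroCol A)ᵀ *ᵥ h) * (appendZeroCol B)ᵀ) *ᵥ x =
      (C * Matrix.diagonal (Aᵀ *ᵥ h) * Bᵀ) *ᵥ x := by
  ext i
  simp only [mul_diagonal_mul_transpose_mulVec_apply, Fin.sum_univ_castSucc]
  simp [appendZeroCol, Matrix.mulVec, dotProduct]

/-- Regard a rank `R` network as a rank `R + 1` network by appending zero columns. -/
def CPBIRNN.pad {d n R : ℕ} (net : CPBIRNN d n R) : CPBIRNN d n (R + 1) where
  h0 := net.h0
  A l := appendZeroCol (net.A l)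
  B0 := appendZeroCol net.B0
  B l := appendZeroCol (net.B l)
  C l := appendZeroCol (net.C l)

theorem CPBIRNN.pad_state {d n R : ℕ} (net : CPBIRNN d n R) (x : ℕ → Fin d → ℝ) (l t : ℕ) :
    net.pad.state x l t = net.state x l t := by
  induction l generalizing t with
  | zero =>
    induction t with
    | zero => simp only [CPBIRNN.state]; rfl
    | succ t ih => simp only [CPBIRNN.state, ih]; exact appendZeroCol_layer ..
  | succ l ihl =>
    induction t with
    | zero => simp only [CPBIRNN.state]; rfl
    | succ t ih => simp only [CPBIRNN.state, ih, ihl]; exact appendZeroCol_layer ..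

theorem cpbirnnClass_subset_succ_rank (d n L R : ℕ) :
    CPBIRNNclass d n L R ⊆ CPBIRNNclass d n L (R + 1) := by
  rintro f ⟨net, hf⟩
  exact ⟨net.pad, fun T x t => by rw [CPBIRNN.pad_state, hf]⟩

theorem CPBIRNN.state_succ_mem_range {d n R : ℕ} (net : CPBIRNN d n R) (x : ℕ → Fin d → ℝ)
    (l t : ℕ) : net.state x l (t + 1) ∈ LinearMap.range (net.C l).mulVecLin := by
  cases l <;>
  · simp only [CPBIRNN.state, ← Matrix.mulVec_mulVec]
    exact LinearMap.mem_range_self (Matrix.mulVecLin _) _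

/-- The network each of whose layers cyclically shifts the first `R + 1` basis vectors, scaled by
the sum of the coordinates of the input of that layer. -/
def cyclicNet (d n R : ℕ) (h : R + 1 ≤ n) : CPBIRNN d n (R + 1) where
  h0 _ := Pi.single (Fin.castLE h (-1)) 1
  A _ := Matrix.of fun i r => if i = Fin.castLE h (r - 1) then 1 else 0
  B0 := Matrix.of fun _ _ => 1
  B _ := Matrix.of fun _ _ => 1
  C _ := Matrix.of fun i r => if i = Fin.castLE h r then 1 else 0

theorem cyclic_layer {m n R : ℕ} (h : R + 1 ≤ n) (s : Fin (R + 1)) (x : Fin m → ℝ)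
    (hx : ∑ j, x j = 1) {A C : Matrix (Fin n) (Fin (R + 1)) ℝ} {B : Matrix (Fin m) (Fin (R + 1)) ℝ}
    (hA : ∀ i r, A i r = if i = Fin.castLE h (r - 1) then 1 else 0) (hB : ∀ i r, B i r = 1)
    (hC : ∀ i r, C i r = if i = Fin.castLE h r then 1 else 0) :
    (C * Matrix.diagonal (Aᵀ *ᵥ Pi.single (Fin.castLE h (s - 1)) 1) * Bᵀ) *ᵥ x =
      Pi.single (Fin.castLE h s) 1 := by
  ext i
  rw [mul_diagonal_mul_transpose_mulVec_apply]
  simp [Matrix.mulVec, dotProduct, hx, hA, hB, hC, Pi.single_apply, Fin.castLE_inj]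

open scoped Fin.CommRing in
theorem cyclicNet_state {d n R : ℕ} (h : R + 1 ≤ n) (x : ℕ → Fin d → ℝ) (T : ℕ)
    (hx : ∀ t < T, ∑ j, x t j = 1) (l t : ℕ) (ht : t ≤ T) :
    (cyclicNet d n R h).state x l t = Pi.single (Fin.castLE h ((t : Fin (R + 1)) - 1)) 1 := by
  induction l generalizing t with
  | zero =>
    induction t with
    | zero => simp [CPBIRNN.state, cyclicNet]
    | succ t ih =>
      simp only [CPBIRNN.state, ih (by omega)]
      rw [Nat.cast_succ, add_sub_cancel_right]
      exact cyclic_layer h _ _ (hx t (by omega)) (fun _ _ => rfl) (fun _ _ => rfl) fun _ _ => rfl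
  | succ l ihl =>
    induction t with
    | zero => simp [CPBIRNN.state, cyclicNet]
    | succ t ih =>
      simp only [CPBIRNN.state, ih (by omega), ihl (t + 1) ht]
      rw [Nat.cast_succ, add_sub_cancel_right]
      exact cyclic_layer h _ _ (by simp) (fun _ _ => rfl) (fun _ _ => rfl) fun _ _ => rfl

open scoped Fin.CommRing in
theorem cyclicNet_state_succ {d n R : ℕ} (h : R + 1 ≤ n) (x : ℕ → Fin d → ℝ)
    (hx : ∀ t < R + 1, ∑ j, x t j = 1) (l : ℕ) (s : Fin (R + 1)) :
    (cyclicNet d n R h).state x l ((s : ℕ) + 1) = Pi.single (Fin.castLE h s) 1 := by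
  rw [cyclicNet_state h x (R + 1) hx l _ s.isLt, Nat.cast_succ, add_sub_cancel_right,
    Fin.cast_val_eq_self]

/-- The column space of a matrix with `R` columns cannot contain `R + 1` distinct standard basis
vectors. -/
theorem not_forall_single_castLE_mem_range {n R : ℕ} (h : R + 1 ≤ n)
    (C : Matrix (Fin n) (Fin R) ℝ) :
    ¬ ∀ s : Fin (R + 1), (Pi.single (Fin.castLE h s) 1 : Fin n → ℝ) ∈
      LinearMap.range C.mulVecLin := by
  intro hmem
  have hli : LinearIndependent ℝ
      fun s : Fin (R + 1) => (Pi.single (Fin.castLE h s) 1 : Fin n → ℝ) :=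
    (Pi.linearIndependent_single_one (Fin n) ℝ).comp _ (Fin.castLE_injective h)
  have hspan : Submodule.span ℝ (Set.range fun s : Fin (R + 1) =>
      (Pi.single (Fin.castLE h s) 1 : Fin n → ℝ)) ≤ LinearMap.range C.mulVecLin :=
    Submodule.span_le.2 (Set.range_subset_iff.2 hmem)
  have hfin := Submodule.finrank_mono hspan
  rw [finrank_span_eq_card hli, Fintype.card_fin] at hfin
  have hrank := LinearMap.finrank_range_le C.mulVecLin
  rw [Module.finrank_fin_fun] at hrank
  omega

/-- For any hidden size `n > 1`, depth `L ≥ 1` and rank `R` with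
`1 ≤ R < n` (and input dimension `d ≥ 1`), linear CPBIRNNs of rank `R` compute a
strict subclass of those of rank `R+1` at the same depth:
`H^CPBIRNN_{n,L,R} ⊊ H^CPBIRNN_{n,L,R+1}`. -/
theorem cpbirnnClass_ssubset_succ_rank (d n L R : ℕ)
    (hd : 0 < d) (hn : 1 < n) (hL : 1 ≤ L) (hR : 1 ≤ R) (hRn : R < n) :
    CPBIRNNclass d n L R ⊂ CPBIRNNclass d n L (R + 1) := by
  refine (Set.ssubset_iff_of_subset (cpbirnnClass_subset_succ_rank d n L R)).2
    ⟨fun T x t => (cyclicNet d n R hRn).state (extSeq x) (L - 1) ((t : ℕ) + 1),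
      ⟨cyclicNet d n R hRn, fun _ _ _ => rfl⟩, ?_⟩
  rintro ⟨net, hnet⟩
  refine not_forall_single_castLE_mem_range hRn (net.C (L - 1)) fun s => ?_
  let x : Fin (R + 1) → Fin d → ℝ := fun _ => Pi.single ⟨0, hd⟩ 1
  have hx : ∀ t < R + 1, ∑ j, extSeq x t j = 1 := fun t ht => by simp [extSeq, ht, x]
  rw [← cyclicNet_state_succ hRn (extSeq x) hx (L - 1) s]
  have hs := hnet (R + 1) x s
  beta_reduce at hs
  rw [hs]
  exact net.state_succ_mem_range _ _ _

end
end

section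
/- There exist an input dimension d, a state dimension n, a tensor A ∈ ℝ^{n×d×n} and a nonzero vector f_0 ∈ ℝ^n such that the single-layer 2RNN function f defined by f_t = f(x_1,…,x_t) with (f_t)_k = Σ_{i,j} A_{i,j,k} (f_{t−1})_i (x_t)_j cannot be computed by any depthwise-activated RNN of any finite depth L and width ñ: there are no matrices U^(l), V^(l), biases b^(l), homeomorphism activations φ^(l) : ℝ^ñ → ℝ^ñ, and linear map ℓ : ℝ^ñ → ℝ^n such that, with y_t^(0) := x_t, h_t^(l) = U^(l) y_t^(l−1) + V^(l) h_{t−1}^(l) + b^(l), and y_t^(l) = φ^(l)(h_t^(l)), one has f_t = ℓ(y_t^(L)) for all input sequences and all time steps t. -/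
open Matrix

noncomputable section

/-- The single-layer 2RNN (bilinear-only) state function determined by a tensor
`A : ℝ^{n×d×n}` (entries `A i j k = A_{i,j,k}`) and initial state `f0`:
`(f_t)_k = Σ_{i,j} A_{i,j,k} (f_{t-1})_i (x_t)_j` (input 0-indexed: `x t` is the
paper's `x_{t+1}`). -/
def birnn1 {d n : ℕ} (A : Fin n → Fin d → Fin n → ℝ) (f0 : Fin n → ℝ)
    (x : ℕ → Fin d → ℝ) : ℕ → Fin n → ℝ
  | 0 => f0
  | t + 1 => fun k => ∑ i, ∑ j, A i j k * birnn1 A f0 x t i * x t j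

/-- A depthwise-activated RNN of input dimension `d` and width `m` (ℕ-indexed layer
parameters; a network of depth `L` only uses layers `0,…,L-1`): linear-in-time
recurrences `h_t^{(l)} = U^{(l)} y_t^{(l-1)} + V^{(l)} h_{t-1}^{(l)} + b^{(l)}` with
`y_t^{(l)} = φ^{(l)}(h_t^{(l)})`, `y_t^{(0)} = x_t`, where each activation
`φ^{(l)} : ℝ^m → ℝ^m` is a homeomorphism applied only in depth (not in time). -/
structure DWRNN (d m : ℕ) where
  h0 : ℕ → Fin m → ℝ
  U0 : Matrix (Fin m) (Fin d) ℝ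
  U : ℕ → Matrix (Fin m) (Fin m) ℝ
  V : ℕ → Matrix (Fin m) (Fin m) ℝ
  b : ℕ → Fin m → ℝ
  act : ℕ → (Fin m → ℝ) ≃ₜ (Fin m → ℝ)

/-- `net.state x l t` is the pre-activation hidden state `h_t^{(l+1)}` (layer `l`
0-indexed, time `t` with `t = 0` the initial state). -/
def DWRNN.state {d m : ℕ} (net : DWRNN d m) (x : ℕ → Fin d → ℝ) : ℕ → ℕ → Fin m → ℝ
  | 0, 0 => net.h0 0
  | 0, t + 1 => net.U0 *ᵥ x t + net.V 0 *ᵥ DWRNN.state net x 0 t + net.b 0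
  | l + 1, 0 => net.h0 (l + 1)
  | l + 1, t + 1 =>
      net.U (l + 1) *ᵥ (net.act l (DWRNN.state net x l (t + 1)))
        + net.V (l + 1) *ᵥ DWRNN.state net x (l + 1) t + net.b (l + 1)
  termination_by l t => (l, t)

theorem exists_mvPolynomial_near {X κ : Type*} [TopologicalSpace X] [CompactSpace X]
    (g : κ → C(X, ℝ)) (hg : ∀ x y : X, (∀ i, g i x = g i y) → x = y)
    (f : C(X, ℝ)) {ε : ℝ} (hε : 0 < ε) :
    ∃ P : MvPolynomial κ ℝ, ∀ x, |MvPolynomial.eval (fun i => g i x) P - f x| < ε := by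
  have hsep : (Algebra.adjoin ℝ (Set.range g)).SeparatesPoints := by
    intro x y hxy
    obtain ⟨i, hi⟩ : ∃ i, g i x ≠ g i y := by
      by_contra! h
      exact hxy (hg x y h)
    exact ⟨g i, ⟨g i, Algebra.subset_adjoin ⟨i, rfl⟩, rfl⟩, hi⟩
  obtain ⟨⟨q, hq⟩, hqf⟩ :=
    ContinuousMap.exists_mem_subalgebra_near_continuousMap_of_separatesPoints _ hsep f ε hε
  rw [Algebra.adjoin_range_eq_range_aeval] at hq
  obtain ⟨P, rfl⟩ := hq
  refine ⟨P, fun x => ?_⟩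
  have h1 := (ContinuousMap.norm_coe_le_norm _ x).trans_lt hqf
  have h2 : (MvPolynomial.aeval g P : C(X, ℝ)) x = MvPolynomial.eval (fun i => g i x) P := by
    rw [← MvPolynomial.coe_aeval_eq_eval]
    exact MvPolynomial.comp_aeval_apply g (ContinuousMap.evalAlgHom ℝ ℝ x) P
  simpa [h2] using h1

theorem det_one_add_pos {E : Type*} [NormedAddCommGroup E] [NormedSpace ℝ E]
    [FiniteDimensional ℝ E] (A : E →L[ℝ] E) (hA : ‖A‖ < 1) :
    0 < (1 + A : E →L[ℝ] E).det := by
  have : CompleteSpace E := FiniteDimensional.complete ℝ E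
  by_contra! h
  have hcont : Continuous fun s : ℝ => (1 + s • A : E →L[ℝ] E).det :=
    ContinuousLinearMap.continuous_det.comp (by fun_prop)
  obtain ⟨s, ⟨hs0, hs1⟩, hs⟩ := intermediate_value_Icc' zero_le_one hcont.continuousOn
    (show (0 : ℝ) ∈ _ by simpa [ContinuousLinearMap.det] using h)
  have hu : IsUnit (1 - (-(s • A)) : E →L[ℝ] E) := by
    apply isUnit_one_sub_of_norm_lt_one
    rw [norm_neg, norm_smul, Real.norm_of_nonneg hs0]
    nlinarith [norm_nonneg A]
  rw [sub_neg_eq_add] at hu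
  have h2 : IsUnit (LinearMap.det ((1 + s • A : E →L[ℝ] E) : E →ₗ[ℝ] E)) :=
    (hu.map (ContinuousLinearMap.toLinearMapRingHom : (E →L[ℝ] E) →+* (E →ₗ[ℝ] E))).map
      LinearMap.det
  exact h2.ne_zero hs

theorem bijective_add_of_lipschitzWith {E : Type*} [NormedAddCommGroup E] [NormedSpace ℝ E]
    [CompleteSpace E] {u : E → E} {c : NNReal} (hu : LipschitzWith c u) (hc : c < 1) :
    Function.Bijective fun x => x + u x := by
  have happ : ApproximatesLinearOn (fun x => x + u x)
      ((ContinuousLinearEquiv.refl ℝ E : E ≃L[ℝ] E) : E →L[ℝ] E) Set.univ c := by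
    intro x _ y _
    have h : x + u x - (y + u y) - (x - y) = u x - u y := by abel
    simpa only [← h] using! hu.norm_sub_le x y
  have hN : Subsingleton E ∨
      c < ‖((ContinuousLinearEquiv.refl ℝ E).symm : E →L[ℝ] E)‖₊⁻¹ := by
    rcases subsingleton_or_nontrivial E with h | h
    · exact Or.inl h
    · right
      have : ((ContinuousLinearEquiv.refl ℝ E).symm : E →L[ℝ] E)
        = ContinuousLinearMap.id ℝ E := rfl
      rw [this]
      simpa using hc
  exact ⟨Set.injOn_univ.1 (happ.injOn hN), happ.surjective hN⟩

/-- `∫ ρ(x + t u(x)) det(1 + t Du(x))` is a polynomial function of `t`. -/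
theorem exists_polynomial_integral_eq {ι : Type*} [Fintype ι] [DecidableEq ι]
    {u : (ι → ℝ) → ι → ℝ} (hu : ContDiff ℝ 1 u) (ρ : MvPolynomial ι ℝ)
    {S : Set (ι → ℝ)} (hS : IsCompact S) :
    ∃ P : Polynomial ℝ, ∀ t : ℝ, P.eval t =
      ∫ x in S, MvPolynomial.eval (x + t • u x) ρ *
        (1 + t • fderiv ℝ u x : (ι → ℝ) →L[ℝ] ι → ℝ).det := by
  have hu' := hu.continuous_fderiv one_ne_zero
  let X : ι → C(ι → ℝ, ℝ) := fun i => ⟨fun x => x i, by fun_prop⟩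
  let U : ι → C(ι → ℝ, ℝ) := fun i => ⟨fun x => u x i, by have := hu.continuous; fun_prop⟩
  let D : ι → ι → C(ι → ℝ, ℝ) := fun i j =>
    ⟨fun x => fderiv ℝ u x (Pi.single j 1) i, by fun_prop⟩
  let p : Polynomial C(ι → ℝ, ℝ) :=
    MvPolynomial.aeval (fun i => Polynomial.C (X i) + Polynomial.X * Polynomial.C (U i)) ρ *
    (1 + Matrix.of fun i j => Polynomial.X * Polynomial.C (D i j)).det
  have hp : ∀ t x, p.eval₂ ((ContinuousMap.evalAlgHom ℝ ℝ x : C(ι → ℝ, ℝ) →ₐ[ℝ] ℝ) :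
      C(ι → ℝ, ℝ) →+* ℝ) t = MvPolynomial.eval (x + t • u x) ρ *
        (1 + t • fderiv ℝ u x : (ι → ℝ) →L[ℝ] ι → ℝ).det := by
    intro t x
    rw [← Polynomial.coe_eval₂RingHom]
    simp only [p, map_mul]
    congr 1
    · rw [MvPolynomial.map_aeval, MvPolynomial.eval, MvPolynomial.coe_eval₂Hom,
        MvPolynomial.coe_eval₂Hom]
      congr 1
      · ext r
        simp
      · ext i
        simp [X, U, mul_comm t]
    · rw [RingHom.map_det, ContinuousLinearMap.det, ← LinearMap.det_toMatrix']
      congr 1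
      ext i j
      simp [LinearMap.toMatrix'_apply, D, Matrix.one_apply, Pi.single_apply, mul_comm t]
      split_ifs <;> simp
  refine ⟨∑ k ∈ Finset.range (p.natDegree + 1),
    Polynomial.monomial k (∫ x in S, p.coeff k x), fun t => ?_⟩
  simp_rw [← hp, Polynomial.eval₂_eq_sum_range]
  rw [MeasureTheory.integral_finsetSum]
  · simp [Polynomial.eval_finsetSum, MeasureTheory.integral_mul_const]
  · intro k _
    exact (((p.coeff k).continuous.mul continuous_const).continuousOn).integrableOn_compact hS

/-- The degree formula for a compactly supported perturbation of the identity. -/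
theorem integral_comp_add_mul_det_eq {ι : Type*} [Fintype ι] [DecidableEq ι]
    {u : (ι → ℝ) → ι → ℝ} (hu : ContDiff ℝ 1 u) (ρ : MvPolynomial ι ℝ)
    {S : Set (ι → ℝ)} (hS : IsCompact S) (huS : ∀ x ∉ S, u x = 0) :
    ∫ x in S, MvPolynomial.eval (x + u x) ρ * (1 + fderiv ℝ u x : (ι → ℝ) →L[ℝ] ι → ℝ).det =
      ∫ x in S, MvPolynomial.eval x ρ := by
  obtain ⟨P, hP⟩ := exists_polynomial_integral_eq hu ρ hS
  have hsupp : HasCompactSupport u := HasCompactSupport.intro hS huS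
  obtain ⟨C, hC⟩ := hu.lipschitzWith_of_hasCompactSupport hsupp one_ne_zero
  have hsmall : ∀ t : NNReal, t * C < 1 → P.eval (t : ℝ) = ∫ x in S, MvPolynomial.eval x ρ := by
    intro t ht
    rw [hP]
    have hlip : LipschitzWith (t * C) fun x => (t : ℝ) • u x := by
      refine LipschitzWith.of_dist_le_mul fun x y => ?_
      rw [dist_smul₀, NNReal.coe_mul, mul_assoc, Real.norm_of_nonneg t.coe_nonneg]
      exact mul_le_mul_of_nonneg_left (hC.dist_le_mul x y) t.coe_nonneg
    obtain ⟨hinj, hsurj⟩ := bijective_add_of_lipschitzWith hlip ht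
    have hfix : ∀ x ∉ S, x + (t : ℝ) • u x = x := fun x hx => by simp [huS x hx]
    have himage : (fun x => x + (t : ℝ) • u x) '' S = S := by
      ext y
      constructor
      · rintro ⟨x, hx, rfl⟩
        by_contra hy
        exact hy (by rwa [hinj (hfix _ hy)])
      · intro hy
        obtain ⟨x, rfl⟩ := hsurj y
        refine ⟨x, ?_, rfl⟩
        by_contra hx
        exact hx (by simpa only [hfix x hx] using hy)
    have hderiv : ∀ x ∈ S, HasFDerivWithinAt (fun x => x + (t : ℝ) • u x)
        (1 + (t : ℝ) • fderiv ℝ u x : (ι → ℝ) →L[ℝ] ι → ℝ) S x := fun x _ =>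
      ((hasFDerivAt_id x).add
        ((hu.differentiable one_ne_zero x).hasFDerivAt.const_smul (t : ℝ))).hasFDerivWithinAt
    conv_rhs => rw [← himage, MeasureTheory.integral_image_eq_integral_abs_det_fderiv_smul _
      hS.measurableSet hderiv hinj.injOn]
    congr 1
    ext x
    have hpos : 0 < (1 + (t : ℝ) • fderiv ℝ u x : (ι → ℝ) →L[ℝ] ι → ℝ).det := by
      apply det_one_add_pos
      refine lt_of_le_of_lt ?_ (show ((t * C : NNReal) : ℝ) < 1 by exact_mod_cast ht)
      rw [norm_smul, NNReal.coe_mul, Real.norm_of_nonneg t.coe_nonneg]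
      exact mul_le_mul_of_nonneg_left (norm_fderiv_le_of_lipschitz ℝ hC) t.coe_nonneg
    rw [abs_of_pos hpos, smul_eq_mul, mul_comm]
  have hconst : P = Polynomial.C (∫ x in S, MvPolynomial.eval x ρ) := by
    apply Polynomial.eq_of_infinite_eval_eq
    refine (Set.Icc_infinite (show (0 : ℝ) < 1 / (C + 1) by positivity)).mono ?_
    rintro t ⟨ht0, ht1⟩
    lift t to NNReal using ht0
    rw [Set.mem_ofPred_eq, Polynomial.eval_C]
    apply hsmall
    rw [← NNReal.coe_lt_coe]
    push_cast
    rw [le_div_iff₀ (by positivity)] at ht1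
    rcases eq_or_ne t 0 with rfl | h
    · simp
    · have : (0 : ℝ) < t := by positivity
      nlinarith
  have h1 := hP 1
  rw [hconst, Polynomial.eval_C] at h1
  simpa using h1.symm

theorem det_fderiv_comp_eq_zero {ι κ : Type*} [Fintype ι] [Fintype κ]
    (hcard : Fintype.card κ < Fintype.card ι) {q : (ι → ℝ) → κ → ℝ} {P : (κ → ℝ) → ι → ℝ}
    (hq : Differentiable ℝ q) (hP : Differentiable ℝ P) (x : ι → ℝ) :
    (fderiv ℝ (fun x => P (q x)) x).det = 0 := by
  have := fderiv_comp x (hP (q x)) (hq x)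
  rw [Function.comp_def] at this
  rw [this, ContinuousLinearMap.det, LinearMap.det_eq_zero_iff_ker_ne_bot]
  obtain ⟨v, hv, hv0⟩ := Submodule.exists_mem_ne_zero_of_ne_bot
    (LinearMap.ker_ne_bot_of_finrank_lt
      (f := (fderiv ℝ q x : (ι → ℝ) →ₗ[ℝ] (κ → ℝ))) (by simpa using hcard))
  refine (Submodule.ne_bot_iff _).2 ⟨v, ?_, hv0⟩
  rw [LinearMap.mem_ker] at hv ⊢
  have hv' : fderiv ℝ q x v = 0 := hv
  simp [hv']

theorem contDiff_mvPolynomial_eval {κ : Type*} [Fintype κ] (P : MvPolynomial κ ℝ) :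
    ContDiff ℝ 1 fun y : κ → ℝ => MvPolynomial.eval y P := by
  rw [← contDiffOn_univ]
  exact (AnalyticOnNhd.eval_mvPolynomial P).contDiffOn uniqueDiffOn_univ

/-- A continuous injection into a lower-dimensional space would make the identity of a ball
a uniform limit of smooth maps of everywhere degenerate differential. -/
theorem exists_contDiff_near_id_det_eq_zero {ι κ : Type*} [Fintype ι] [Fintype κ]
    (hcard : Fintype.card κ < Fintype.card ι) {g : (ι → ℝ) → κ → ℝ} (hg : Continuous g)
    (hinj : Function.Injective g) {K : Set (ι → ℝ)} (hK : IsCompact K) {ε : ℝ} (hε : 0 < ε) :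
    ∃ Q : (ι → ℝ) → ι → ℝ, ContDiff ℝ 1 Q ∧ (∀ x ∈ K, ‖Q x - x‖ ≤ ε) ∧
      ∀ x, (fderiv ℝ Q x).det = 0 := by
  have : CompactSpace K := isCompact_iff_compactSpace.1 hK
  choose P hP using fun i : ι => exists_mvPolynomial_near (X := K)
    (fun k => ⟨fun x => g x k, by fun_prop⟩)
    (fun x y h => Subtype.ext (hinj (funext h))) ⟨fun x => (x : ι → ℝ) i, (continuous_apply i).comp continuous_subtype_val⟩
    (half_pos hε)
  simp only [ContinuousMap.coe_mk] at hP
  have hPdiff : ContDiff ℝ 1 fun (y : κ → ℝ) i => MvPolynomial.eval y (P i) :=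
    contDiff_pi.2 fun i => contDiff_mvPolynomial_eval (P i)
  obtain ⟨δ, hδ, hPδ⟩ := Metric.mem_uniformity_dist.1 <|
    (hK.image hg).uniformContinuousAt_of_continuousAt
      (fun (y : κ → ℝ) i => MvPolynomial.eval y (P i))
      (fun _ _ => hPdiff.continuous.continuousAt) (Metric.dist_mem_uniformity (half_pos hε))
  choose q hq using fun k : κ => exists_mvPolynomial_near (X := K)
    (fun i => ⟨fun x => (x : ι → ℝ) i, (continuous_apply i).comp continuous_subtype_val⟩)
    (fun x y h => Subtype.ext (funext h)) ⟨fun x => g x k, by fun_prop⟩ hδ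
  simp only [ContinuousMap.coe_mk] at hq
  have hqdiff : ContDiff ℝ 1 fun (x : ι → ℝ) k => MvPolynomial.eval x (q k) :=
    contDiff_pi.2 fun k => contDiff_mvPolynomial_eval (q k)
  refine ⟨_, hPdiff.comp hqdiff, fun x hx => ?_, fun x => det_fderiv_comp_eq_zero hcard
    (hqdiff.differentiable one_ne_zero) (hPdiff.differentiable one_ne_zero) x⟩
  have h1 : dist (g x) (fun k => MvPolynomial.eval x (q k)) < δ := by
    rw [dist_comm, dist_pi_lt_iff hδ]
    exact fun k => hq k ⟨x, hx⟩
  have h2 := hPδ h1 (Set.mem_image_of_mem g hx)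
  have h3 : dist (fun i => MvPolynomial.eval (g x) (P i)) x < ε / 2 := by
    rw [dist_pi_lt_iff (half_pos hε)]
    exact fun i => hP i ⟨x, hx⟩
  rw [← dist_eq_norm]
  refine (dist_triangle_left _ _ _).trans ((add_lt_add h2 h3).le.trans (by linarith))

/-- A weak form of invariance of domain. -/
theorem not_injective_of_card_lt_of_continuous {ι κ : Type*} [Fintype ι] [Fintype κ]
    (hcard : Fintype.card κ < Fintype.card ι) {g : (ι → ℝ) → κ → ℝ} (hg : Continuous g) :
    ¬ Function.Injective g := by
  classical
  intro hinj
  let S : Set (ι → ℝ) := Metric.closedBall 0 2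
  have hS : IsCompact S := isCompact_closedBall 0 2
  obtain ⟨Q, hQ, hQid, hQdet⟩ :=
    exists_contDiff_near_id_det_eq_zero hcard hg hinj hS (show (0 : ℝ) < 1 / 4 by norm_num)
  let χ : ContDiffBump (0 : ι → ℝ) := ⟨1, 2, one_pos, one_lt_two⟩
  let u : (ι → ℝ) → ι → ℝ := fun x => χ x • (Q x - x)
  have hu : ContDiff ℝ 1 u := χ.contDiff.smul (hQ.sub contDiff_id)
  have huS : ∀ x ∉ S, u x = 0 := fun x hx => by
    have : χ x = 0 := χ.zero_of_le_dist (by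
      simp only [S, Metric.mem_closedBall, not_le] at hx
      exact hx.le)
    simp [u, this]
  have hunorm : ∀ x, ‖u x‖ ≤ 1 / 4 := fun x => by
    by_cases hx : x ∈ S
    · rw [norm_smul, Real.norm_of_nonneg χ.nonneg]
      exact (mul_le_of_le_one_left (norm_nonneg _) χ.le_one).trans (hQid x hx)
    · rw [huS x hx]
      norm_num
  have hdet : ∀ x, ‖x‖ < 1 → (1 + fderiv ℝ u x : (ι → ℝ) →L[ℝ] ι → ℝ).det = 0 := by
    intro x hx
    have hQx : (fun x => x + u x) =ᶠ[nhds x] Q := by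
      filter_upwards [Metric.isOpen_ball.mem_nhds
        (show x ∈ Metric.ball (0 : ι → ℝ) 1 by simpa using hx)] with y hy
      simp [u, χ.one_of_mem_closedBall (Metric.ball_subset_closedBall hy)]
    rw [← hQdet x, ← hQx.fderiv_eq]
    congr 1
    exact (((hasFDerivAt_id x).add
      (hu.differentiable one_ne_zero x).hasFDerivAt).fderiv).symm
  let X : Set (ι → ℝ) := Metric.closedBall 0 3
  have : CompactSpace X := isCompact_iff_compactSpace.1 (isCompact_closedBall 0 3)
  let ρ : (ι → ℝ) → ℝ := fun y => max 0 (1 / 2 - ‖y‖)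
  have hρ : Continuous ρ := by fun_prop
  have hρpos : 0 < ∫ x in S, ρ x := by
    rw [MeasureTheory.setIntegral_pos_iff_support_of_nonneg_ae]
    · refine lt_of_lt_of_le (Metric.measure_ball_pos MeasureTheory.volume (0 : ι → ℝ)
        (show (0 : ℝ) < 1 / 2 by norm_num)) (MeasureTheory.measure_mono ?_)
      intro x hx
      rw [mem_ball_zero_iff] at hx
      refine ⟨?_, by simpa [S] using by linarith⟩
      exact (lt_max_of_lt_right (by linarith)).ne'
    · exact Filter.Eventually.of_forall fun x => le_max_left _ _
    · exact hρ.continuousOn.integrableOn_compact hS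
  let d : (ι → ℝ) → ℝ := fun x => (1 + fderiv ℝ u x : (ι → ℝ) →L[ℝ] ι → ℝ).det
  have hd : Continuous d :=
    ContinuousLinearMap.continuous_det.comp (continuous_const.add
      (hu.continuous_fderiv one_ne_zero))
  have hdint : MeasureTheory.IntegrableOn (fun x => |d x|) S :=
    hd.abs.continuousOn.integrableOn_compact hS
  have h1int : MeasureTheory.IntegrableOn (fun _ : ι → ℝ => (1 : ℝ)) S :=
    continuousOn_const.integrableOn_compact hS
  set M := ∫ x in S, |d x| with hM
  set v := ∫ _ in S, (1 : ℝ) with hv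
  have hM0 : 0 ≤ M := MeasureTheory.integral_nonneg fun x => abs_nonneg _
  have hv0 : 0 ≤ v := MeasureTheory.integral_nonneg fun x => zero_le_one
  obtain ⟨η, hη, hηlt⟩ : ∃ η > 0, η * (M + v) < ∫ x in S, ρ x := by
    refine ⟨(∫ x in S, ρ x) / (M + v + 1), by positivity, ?_⟩
    rw [div_mul_eq_mul_div, div_lt_iff₀ (by positivity)]
    nlinarith
  obtain ⟨P, hP⟩ := exists_mvPolynomial_near (X := X)
    (fun i => ⟨fun x => (x : ι → ℝ) i, (continuous_apply i).comp continuous_subtype_val⟩)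
    (fun x y h => Subtype.ext (funext h)) ⟨fun x => ρ x, by fun_prop⟩ hη
  have hP' : ∀ x, ‖x‖ ≤ 3 → |MvPolynomial.eval x P - ρ x| < η := fun x hx =>
    hP ⟨x, by simpa [X] using hx⟩
  have hPcont : Continuous fun x : ι → ℝ => MvPolynomial.eval x P :=
    MvPolynomial.continuous_eval P
  have hkey := integral_comp_add_mul_det_eq hu P hS huS
  have hleft : ∫ x in S, MvPolynomial.eval (x + u x) P * d x ≤ η * M := by
    rw [hM, ← MeasureTheory.integral_const_mul]
    apply MeasureTheory.setIntegral_mono_on _ (hdint.const_mul η) hS.measurableSet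
    · intro x hx
      rw [mem_closedBall_zero_iff] at hx
      rcases lt_or_ge ‖x‖ 1 with h | h
      · simp [d, hdet x h]
      · have h1 : ‖x + u x‖ ≤ 3 := (norm_add_le _ _).trans (by linarith [hunorm x])
        have h2 : ρ (x + u x) = 0 := by
          refine max_eq_left ?_
          have := norm_sub_le (x + u x) (u x)
          rw [add_sub_cancel_right] at this
          linarith [hunorm x]
        have h3 := hP' _ h1
        rw [h2, sub_zero] at h3
        refine (le_abs_self _).trans ?_
        rw [abs_mul]
        exact mul_le_mul_of_nonneg_right h3.le (abs_nonneg _)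
    · exact ((hPcont.comp (continuous_id.add hu.continuous)).mul
        hd).continuousOn.integrableOn_compact hS
  have hright : (∫ x in S, ρ x) - η * v ≤ ∫ x in S, MvPolynomial.eval x P := by
    rw [hv, ← MeasureTheory.integral_const_mul, ← MeasureTheory.integral_sub
      (hρ.continuousOn.integrableOn_compact hS) (h1int.const_mul η)]
    apply MeasureTheory.setIntegral_mono_on
      ((hρ.continuousOn.integrableOn_compact hS).sub (h1int.const_mul η))
      (hPcont.continuousOn.integrableOn_compact hS) hS.measurableSet
    intro x hx
    rw [mem_closedBall_zero_iff] at hx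
    have := (abs_lt.1 (hP' x (by linarith))).1
    change ρ x - η * 1 ≤ MvPolynomial.eval x P
    linarith
  linarith [hkey.symm.le]

theorem pow_mulVec_eq_zero_of_add {m : ℕ} (V : Matrix (Fin m) (Fin m) ℝ) (k : ℕ)
    {v : Fin m → ℝ} (h : V ^ (m + k) *ᵥ v = 0) : V ^ m *ᵥ v = 0 := by
  have hker := Module.End.ker_pow_eq_ker_pow_finrank_of_le (f := Matrix.toLin' V) (m := m + k)
    (by simp)
  rw [Module.finrank_fin_fun, ← Matrix.toLin'_pow, ← Matrix.toLin'_pow] at hker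
  have hv : v ∈ LinearMap.ker (Matrix.toLin' (V ^ (m + k))) := by
    rwa [LinearMap.mem_ker, Matrix.toLin'_apply]
  rwa [hker, LinearMap.mem_ker, Matrix.toLin'_apply] at hv

/-- Along a linear recurrence, vanishing modulo the generalized kernel propagates backwards,
and `m` further steps turn it into actual vanishing. -/
theorem linear_recurrence_backward {m : ℕ} (V : Matrix (Fin m) (Fin m) ℝ)
    (δ : ℕ → Fin m → ℝ) {s T : ℕ} (hsT : s ≤ T)
    (hδ : ∀ t, s ≤ t → t < T → δ (t + 1) = V *ᵥ δ t) (hT : V ^ m *ᵥ δ T = 0) :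
    (∀ t, s ≤ t → t ≤ T → V ^ m *ᵥ δ t = 0) ∧ ∀ t, s + m ≤ t → t ≤ T → δ t = 0 := by
  have hpow : ∀ k, s + k ≤ T → δ (s + k) = V ^ k *ᵥ δ s := by
    intro k
    induction k with
    | zero => simp
    | succ k ih =>
      intro hk
      rw [← add_assoc, hδ (s + k) (by omega) (by omega), ih (by omega), Matrix.mulVec_mulVec,
        ← pow_succ']
  have hs : V ^ m *ᵥ δ s = 0 := by
    apply pow_mulVec_eq_zero_of_add V (T - s)
    rw [pow_add, ← Matrix.mulVec_mulVec, ← hpow (T - s) (by omega)]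
    rwa [Nat.add_sub_cancel' hsT]
  have hzero : ∀ k, V ^ (m + k) *ᵥ δ s = 0 := fun k => by
    rw [add_comm, pow_add, ← Matrix.mulVec_mulVec, hs, Matrix.mulVec_zero]
  constructor
  · intro t hst htT
    obtain ⟨k, rfl⟩ := Nat.exists_eq_add_of_le hst
    rw [hpow k htT, Matrix.mulVec_mulVec, ← pow_add, hzero]
  · intro t hst htT
    obtain ⟨k, rfl⟩ := Nat.exists_eq_add_of_le hst
    rw [add_assoc, hpow (m + k) (by omega), hzero]

namespace DWRNN

variable {d m : ℕ} (net : DWRNN d m)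

/-- Two runs agree in layer `l` at time `t` up to what the recurrence eventually forgets. -/
def StableEq (x x' : ℕ → Fin d → ℝ) (l t : ℕ) : Prop :=
  net.V l ^ m *ᵥ (net.state x l t - net.state x' l t) = 0

/-- Each layer costs `m` steps of backward determinism. -/
theorem stableEq_backward {x x' : ℕ → Fin d → ℝ} {L s T : ℕ}
    (hx : ∀ t, s ≤ t → t < T → x t = x' t) (hT : ∀ l < L, net.StableEq x x' l T)
    (l : ℕ) (hl : l < L) :
    (∀ t, s + l * m ≤ t → t ≤ T → net.StableEq x x' l t) ∧
      ∀ t, s + (l + 1) * m ≤ t → t ≤ T → net.state x l t = net.state x' l t := by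
  induction l with
  | zero =>
    rcases le_or_gt s T with hsT | hsT
    · have := linear_recurrence_backward (net.V 0)
        (fun t => net.state x 0 t - net.state x' 0 t) hsT (fun t h1 h2 => by
          simp only [DWRNN.state, hx t h1 h2, Matrix.mulVec_sub]
          abel) (hT 0 hl)
      refine ⟨fun t h1 h2 => this.1 t (by omega) h2, fun t h1 h2 => ?_⟩
      exact sub_eq_zero.1 (this.2 t (by omega) h2)
    · exact ⟨fun t h1 h2 => by omega, fun t h1 h2 => by omega⟩
  | succ l ih =>
    rw [add_one_mul (l + 1) m]
    rcases le_or_gt (s + (l + 1) * m) T with hsT | hsT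
    · have := linear_recurrence_backward (net.V (l + 1))
        (fun t => net.state x (l + 1) t - net.state x' (l + 1) t) hsT (fun t h1 h2 => by
          simp only [DWRNN.state, (ih (by omega)).2 (t + 1) (by omega) h2, Matrix.mulVec_sub]
          abel) (hT (l + 1) hl)
      refine ⟨this.1, fun t h1 h2 => ?_⟩
      exact sub_eq_zero.1 (this.2 t (by omega) h2)
    · exact ⟨fun t h1 h2 => by omega, fun t h1 h2 => by omega⟩

theorem continuous_state {Y : Type*} [TopologicalSpace Y] {x : Y → ℕ → Fin d → ℝ}
    (hx : ∀ t, Continuous fun y => x y t) (l t : ℕ) :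
    Continuous fun y => net.state (x y) l t := by
  induction l generalizing t with
  | zero =>
    induction t with
    | zero => simpa only [DWRNN.state] using continuous_const
    | succ t ih =>
      simp only [DWRNN.state]
      exact ((continuous_const.matrix_mulVec (hx t)).add
        (continuous_const.matrix_mulVec ih)).add continuous_const
  | succ l ihl =>
    induction t with
    | zero => simpa only [DWRNN.state] using continuous_const
    | succ t ih =>
      simp only [DWRNN.state]
      exact ((continuous_const.matrix_mulVec ((net.act l).continuous.comp (ihl (t + 1)))).add
        (continuous_const.matrix_mulVec ih)).add continuous_const
end DWRNN

/-- The gated register `p_t = x₀ p_{t-1} + x₁ c_{t-1}`, `c_t = x₂ c_{t-1}`. -/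
def registerTensor : Fin 2 → Fin 3 → Fin 2 → ℝ :=
  ![![![1, 0], ![0, 0], ![0, 0]], ![![0, 0], ![1, 0], ![0, 1]]]

/-- Inputs that overwrite the register with `b j` at the start of the `j`-th block of length
`K + 1` and keep it for the rest of the block. -/
def registerInput (K : ℕ) (b : ℕ → ℝ) (t : ℕ) : Fin 3 → ℝ :=
  if t % (K + 1) = 0 then ![0, b (t / (K + 1)), 1] else ![1, 0, 1]

theorem registerInput_start (K : ℕ) (b : ℕ → ℝ) (j : ℕ) :
    registerInput K b (j * (K + 1)) = ![0, b j, 1] := by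
  simp [registerInput]

theorem registerInput_hold (K : ℕ) (b : ℕ → ℝ) {j t : ℕ} (h1 : j * (K + 1) < t)
    (h2 : t < (j + 1) * (K + 1)) : registerInput K b t = ![1, 0, 1] := by
  have : t % (K + 1) ≠ 0 := by
    obtain ⟨i, rfl⟩ := Nat.exists_eq_add_of_lt h1
    rw [add_assoc, add_comm, Nat.add_mul_mod_self_right, Nat.mod_eq_of_lt (by linarith)]
    omega
  simp [registerInput, this]

theorem birnn1_registerTensor_succ (x : ℕ → Fin 3 → ℝ) (t : ℕ) :
    birnn1 registerTensor ![0, 1] x (t + 1) =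
      ![x t 0 * birnn1 registerTensor ![0, 1] x t 0 + x t 1 * birnn1 registerTensor ![0, 1] x t 1,
        x t 2 * birnn1 registerTensor ![0, 1] x t 1] := by
  ext k
  fin_cases k <;> simp [birnn1, registerTensor, Fin.sum_univ_succ] <;> ring

theorem birnn1_registerInput_one (K : ℕ) (b : ℕ → ℝ) (t : ℕ) :
    birnn1 registerTensor ![0, 1] (registerInput K b) t 1 = 1 := by
  induction t with
  | zero => simp [birnn1]
  | succ t ih =>
    rw [birnn1_registerTensor_succ]
    simp only [Matrix.cons_val_one, Matrix.cons_val_fin_one, ih, registerInput]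
    split_ifs <;> simp

theorem birnn1_registerInput_zero (K : ℕ) (b : ℕ → ℝ) (j i : ℕ) (hi : i ≤ K) :
    birnn1 registerTensor ![0, 1] (registerInput K b) (j * (K + 1) + i + 1) 0 = b j := by
  induction i with
  | zero =>
    rw [birnn1_registerTensor_succ, registerInput_start]
    simp [birnn1_registerInput_one]
  | succ i ih =>
    rw [birnn1_registerTensor_succ, registerInput_hold K b (j := j) (by omega) (by linarith),
      ← add_assoc]
    simpa using ih (by omega)

/-- Agreement of the states at the end of a block determines the block's register value, and
reversing the network through the block gives agreement at the end of the preceding block. -/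
theorem DWRNN.eq_of_stableEq {m : ℕ} (net : DWRNN 3 m) {L : ℕ} (hL : 1 ≤ L)
    {ℓ : (Fin m → ℝ) →ₗ[ℝ] (Fin 2 → ℝ)}
    (hnet : ∀ x t, birnn1 registerTensor ![0, 1] x (t + 1) =
      ℓ (net.act (L - 1) (net.state x (L - 1) (t + 1))))
    {b b' : ℕ → ℝ} (j : ℕ)
    (h : ∀ l < L, net.StableEq (registerInput (L * m) b) (registerInput (L * m) b') l
      ((j + 1) * (L * m + 1))) :
    ∀ i ≤ j, b i = b' i := by
  set K := L * m with hK
  have hhold : ∀ i t, i * (K + 1) < t → t < (i + 1) * (K + 1) →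
      registerInput K b t = registerInput K b' t := fun i t h1 h2 => by
    rw [registerInput_hold K b h1 h2, registerInput_hold K b' h1 h2]
  have hlast : ∀ j, (∀ l < L, net.StableEq (registerInput K b) (registerInput K b') l
      ((j + 1) * (K + 1))) → b j = b' j := fun j h => by
    have hstate := (net.stableEq_backward (s := j * (K + 1) + 1) (T := (j + 1) * (K + 1))
      (fun t h1 h2 => hhold j t h1 h2) h (L - 1) (by omega)).2 (j * (K + 1) + K + 1)
      (by rw [Nat.sub_add_cancel hL]; omega) (by linarith)
    rw [← birnn1_registerInput_zero K b j K le_rfl, ← birnn1_registerInput_zero K b' j K le_rfl,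
      hnet, hnet, hstate]
  induction j with
  | zero =>
    intro i hi
    rw [Nat.le_zero.1 hi, hlast 0 h]
  | succ j ih =>
    have hprev : ∀ i ≤ j, b i = b' i := by
      refine ih fun l hl => ?_
      refine (net.stableEq_backward (s := j * (K + 1) + 1) (T := (j + 1 + 1) * (K + 1))
        (fun t h1 h2 => ?_) h l hl).1 ((j + 1) * (K + 1)) ?_ (by linarith)
      · rcases lt_trichotomy t ((j + 1) * (K + 1)) with ht | rfl | ht
        · exact hhold j t h1 ht
        · rw [registerInput_start, registerInput_start, hlast (j + 1) h]
        · exact hhold (j + 1) t ht h2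
      · have : l * m ≤ K := Nat.mul_le_mul_right m hl.le
        linarith
    intro i hi
    rcases Nat.le_succ_iff.1 hi with hi | rfl
    exacts [hprev i hi, hlast (j + 1) h]

/-- There exist an input dimension `d`, a state dimension `n`, a
tensor `A ∈ ℝ^{n×d×n}` and a nonzero initial state `f0 ∈ ℝ^n` such that the
single-layer 2RNN function `f` they determine cannot be computed by any
depthwise-activated RNN of any finite depth `L` and width `m`: there are no
parameters (matrices, biases, initial states, homeomorphism activations) and linear
readout `ℓ : ℝ^m → ℝ^n` with `f_t = ℓ(y_t^{(L)})` for all input sequences and all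
time steps `t ≥ 1`. -/
theorem exists_sornn_not_depthwise_computable :
    ∃ (d n : ℕ) (A : Fin n → Fin d → Fin n → ℝ) (f0 : Fin n → ℝ),
      f0 ≠ 0 ∧
      ∀ (L m : ℕ), 1 ≤ L →
        ¬ ∃ (net : DWRNN d m) (ℓ : (Fin m → ℝ) →ₗ[ℝ] (Fin n → ℝ)),
          ∀ (x : ℕ → Fin d → ℝ) (t : ℕ),
            birnn1 A f0 x (t + 1) = ℓ (net.act (L - 1) (net.state x (L - 1) (t + 1))) := by
  refine ⟨3, 2, registerTensor, ![0, 1], fun h => by simpa using congrFun h 1, ?_⟩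
  rintro L m hL ⟨net, ℓ, hnet⟩
  let b : (Fin (L * m + 1) → ℝ) → ℕ → ℝ := fun c i =>
    if h : i < L * m + 1 then c ⟨i, h⟩ else 0
  let x : (Fin (L * m + 1) → ℝ) → ℕ → Fin 3 → ℝ := fun c => registerInput (L * m) (b c)
  let g : (Fin (L * m + 1) → ℝ) → Fin L × Fin m → ℝ := fun c p =>
    net.state (x c) p.1 ((L * m + 1) * (L * m + 1)) p.2
  have hb : ∀ i, Continuous fun c => b c i := fun i => by
    by_cases h : i < L * m + 1
    · simpa only [b, h, dite_true] using continuous_apply _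
    · simpa only [b, h, dite_false] using continuous_const
  have hx : ∀ t, Continuous fun c => x c t := fun t => by
    have := hb (t / (L * m + 1))
    by_cases h : t % (L * m + 1) = 0
    · simp only [x, registerInput, h, if_true]
      fun_prop
    · simpa only [x, registerInput, h, if_false] using continuous_const
  have hg : Continuous g := continuous_pi fun p =>
    (continuous_apply p.2).comp (net.continuous_state hx p.1 _)
  refine not_injective_of_card_lt_of_continuous (by simp) hg fun c c' hcc' => ?_
  have heq := net.eq_of_stableEq hL hnet (b := b c) (b' := b c') (L * m) fun l hl => by
    have hstate : net.state (x c) l ((L * m + 1) * (L * m + 1)) =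
        net.state (x c') l ((L * m + 1) * (L * m + 1)) :=
      funext fun k => congrFun hcc' (⟨l, hl⟩, k)
    rw [DWRNN.StableEq, sub_eq_zero.2 hstate, Matrix.mulVec_zero]
  ext i
  simpa [b, Nat.lt_succ_iff.1 i.2] using heq i (Nat.lt_succ_iff.1 i.2)

end
end

section
/- Fix n ≥ d ≥ 1. There is a Lebesgue-null set N ⊂ ℝ^{n×d×n} such that for every tensor A ∉ N and every nonzero f_0 ∈ ℝ^n, the single-layer 2RNN function f defined by f_t with (f_t)_k = Σ_{i,j} A_{i,j,k} (f_{t−1})_i (x_t)_j cannot be computed by any single-layer (L = 1) depthwise-activated RNN of any width ñ: there are no matrices U, V, bias b, homeomorphism activation φ : ℝ^ñ → ℝ^ñ, and linear map ℓ : ℝ^ñ → ℝ^n such that, with h_t = U x_t + V h_{t−1} + b, one has f_t = ℓ(φ(h_t)) for all input sequences and all time steps t. -/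
open Matrix

noncomputable section

/-- The pre-activation state of a single-layer depthwise-activated RNN of width `m`:
`h_t = U x_t + V h_{t-1} + b`, with initial state `h0` (input 0-indexed: `x t` is the
paper's `x_{t+1}`). -/
def rnn1state {d m : ℕ} (U : Matrix (Fin m) (Fin d) ℝ) (V : Matrix (Fin m) (Fin m) ℝ)
    (b h0 : Fin m → ℝ) (x : ℕ → Fin d → ℝ) : ℕ → Fin m → ℝ
  | 0 => h0
  | t + 1 => U *ᵥ x t + V *ᵥ rnn1state U V b h0 x t + b

/-- The state depends additively on the bias, the initial state and the input. -/
theorem rnn1state_add {d m : ℕ} (U : Matrix (Fin m) (Fin d) ℝ) (V : Matrix (Fin m) (Fin m) ℝ)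
    (b h0 b' h0' : Fin m → ℝ) (x y : ℕ → Fin d → ℝ) (t : ℕ) :
    rnn1state U V (b + b') (h0 + h0') (x + y) t =
      rnn1state U V b h0 x t + rnn1state U V b' h0' y t := by
  induction t with
  | zero => rfl
  | succ t ih =>
    simp only [rnn1state, ih, Pi.add_apply, mulVec_add]
    abel

theorem rnn1state_smul {d m : ℕ} (U : Matrix (Fin m) (Fin d) ℝ) (V : Matrix (Fin m) (Fin m) ℝ)
    (b h0 : Fin m → ℝ) (c : ℝ) (x : ℕ → Fin d → ℝ) (t : ℕ) :
    rnn1state U V (c • b) (c • h0) (c • x) t = c • rnn1state U V b h0 x t := by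
  induction t with
  | zero => rfl
  | succ t ih => simp only [rnn1state, ih, Pi.smul_apply, mulVec_smul, smul_add]

/-- The response of the homogeneous recurrence, as a linear function of the input sequence. -/
def rnn1response {d m : ℕ} (U : Matrix (Fin m) (Fin d) ℝ) (V : Matrix (Fin m) (Fin m) ℝ) (t : ℕ) :
    (ℕ → Fin d → ℝ) →ₗ[ℝ] (Fin m → ℝ) where
  toFun x := rnn1state U V 0 0 x t
  map_add' x y := by simpa using rnn1state_add U V 0 0 0 0 x y t
  map_smul' c x := by simpa using rnn1state_smul U V 0 0 c x t

/-- The sequence of inputs along the `j`-th coordinate axis whose first `k` coefficients are `w`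
and whose later terms vanish. -/
def axisInput {d : ℕ} (j : Fin d) (k : ℕ) : (Fin k → ℝ) →ₗ[ℝ] (ℕ → Fin d → ℝ) where
  toFun w s := Pi.single j (if h : s < k then w ⟨s, h⟩ else 0)
  map_add' w w' := by
    funext s
    by_cases h : s < k <;> simp [h, Pi.single_add]
  map_smul' c w := by
    funext s
    by_cases h : s < k <;> simp [h, ← Pi.single_smul]

/-- On inputs along a coordinate axis, the 2RNN state is the product of the coefficients times
the initial state acted on by a power of the corresponding slice of the tensor. -/
theorem birnn1_single {d n : ℕ} (A : Fin n → Fin d → Fin n → ℝ) (f0 : Fin n → ℝ) (j : Fin d)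
    (c : ℕ → ℝ) (t : ℕ) :
    birnn1 A f0 (fun s => Pi.single j (c s)) t =
      (∏ s ∈ Finset.range t, c s) • f0 ᵥ* (Matrix.of fun i k => A i j k) ^ t := by
  induction t with
  | zero => simp [birnn1]
  | succ t ih =>
    have step (g : Fin n → ℝ) (k : Fin n) : ∑ i, ∑ l, A i l k * g i * (Pi.single j (c t) : Fin d → ℝ) l =
        c t * (g ᵥ* (Matrix.of fun i k => A i j k)) k := by
      simp only [Pi.single_apply, mul_ite, mul_zero, Finset.sum_ite_eq', Finset.mem_univ, if_true,
        vecMul, dotProduct, of_apply, Finset.mul_sum]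
      exact Finset.sum_congr rfl fun i _ => by ring
    funext k
    rw [birnn1]
    beta_reduce
    rw [step, ih, pow_succ, ← vecMul_vecMul, smul_vecMul, Finset.prod_range_succ,
      Pi.smul_apply, Pi.smul_apply, smul_eq_mul, smul_eq_mul]
    ring

/-- The tensors whose `j`-th slice is a singular matrix form a null set. -/
theorem volume_setOf_det_slice_eq_zero {d n : ℕ} (j : Fin d) :
    MeasureTheory.volume {A : Fin n → Fin d → Fin n → ℝ |
      (Matrix.of fun i k => A i j k).det = 0} = 0 := by
  let L : ℝ →ₗ[ℝ] (Fin n → Fin d → Fin n → ℝ) :=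
    LinearMap.toSpanSingleton ℝ _ fun i _ k => (1 : Matrix (Fin n) (Fin n) ℝ) i k
  have hcont : Continuous fun A : Fin n → Fin d → Fin n → ℝ =>
      (Matrix.of fun i k => A i j k).det :=
    Continuous.matrix_det (continuous_matrix fun i k => by simp only [of_apply]; fun_prop)
  have hmeas : MeasurableSet {A : Fin n → Fin d → Fin n → ℝ |
      (Matrix.of fun i k => A i j k).det ≠ 0} :=
    (isOpen_ne_fun hcont continuous_const).measurableSet
  have haar : (MeasureTheory.volume :
      MeasureTheory.Measure (Fin d → Fin n → ℝ)).IsAddHaarMeasure :=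
    MeasureTheory.Measure.pi.isAddHaarMeasure _
  have haar' : (MeasureTheory.volume :
      MeasureTheory.Measure (Fin n → Fin d → Fin n → ℝ)).IsAddHaarMeasure :=
    MeasureTheory.Measure.pi.isAddHaarMeasure _
  have key := MeasureTheory.ae_mem_of_ae_add_linearMap_mem L MeasureTheory.volume
    (MeasureTheory.volume : MeasureTheory.Measure (Fin n → Fin d → Fin n → ℝ)) hmeas (fun A => by
      set M : Matrix (Fin n) (Fin n) ℝ := Matrix.of fun i k => A i j k with hM
      have hfin : {x : ℝ | (-M).charpoly.IsRoot x}.Finite :=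
        Polynomial.finite_setOfPred_isRoot (charpoly_monic _).ne_zero
      filter_upwards [MeasureTheory.measure_eq_zero_iff_ae_notMem.1
        (hfin.measure_zero MeasureTheory.volume)] with x hx
      simp only [Polynomial.IsRoot, eval_charpoly] at hx
      convert hx using 3
      ext i k
      simp [L, hM, Matrix.one_apply, Matrix.diagonal_apply, add_comm])
  simpa [MeasureTheory.ae_iff] using key

/-- Fix `n ≥ d ≥ 1`. There is a Lebesgue-null set
`N ⊂ ℝ^{n×d×n}` such that for every tensor `A ∉ N` and every nonzero `f0 ∈ ℝ^n`, the
single-layer 2RNN function they determine cannot be computed by a single-layer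
depthwise-activated RNN of any width `m`: there are no matrices `U, V`, bias `b`
(and initial state `h0`), homeomorphism activation `φ : ℝ^m → ℝ^m`, and linear map
`ℓ : ℝ^m → ℝ^n` with `f_t = ℓ(φ(h_t))` for all input sequences and all time steps
`t ≥ 1`. -/
theorem generic_sornn_not_shallow_depthwise_computable (n d : ℕ) (hd : 1 ≤ d) (hdn : d ≤ n) :
    ∃ N : Set (Fin n → Fin d → Fin n → ℝ),
      MeasureTheory.volume N = 0 ∧
      ∀ A ∉ N, ∀ f0 : Fin n → ℝ, f0 ≠ 0 →
        ∀ m : ℕ,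
          ¬ ∃ (U : Matrix (Fin m) (Fin d) ℝ) (V : Matrix (Fin m) (Fin m) ℝ)
              (b h0 : Fin m → ℝ) (φ : (Fin m → ℝ) ≃ₜ (Fin m → ℝ))
              (ℓ : (Fin m → ℝ) →ₗ[ℝ] (Fin n → ℝ)),
            ∀ (x : ℕ → Fin d → ℝ) (t : ℕ),
              birnn1 A f0 x (t + 1) = ℓ (φ (rnn1state U V b h0 x (t + 1))) := by
  let j : Fin d := ⟨0, hd⟩
  refine ⟨_, volume_setOf_det_slice_eq_zero j, ?_⟩
  rintro A hA f0 hf0 m ⟨U, V, b, h0, φ, ℓ, H⟩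
  set S : Matrix (Fin n) (Fin n) ℝ := Matrix.of fun i k => A i j k with hS
  have hdet : IsUnit (S ^ (m + 1)) :=
    ((isUnit_iff_isUnit_det S).2 (isUnit_iff_ne_zero.2 hA)).pow _
  have hker : LinearMap.ker (rnn1response U V (m + 1) ∘ₗ axisInput j (m + 1)) ≠ ⊥ :=
    LinearMap.ker_ne_bot_of_finrank_lt (by simp)
  obtain ⟨w, hw, hw0⟩ := Submodule.exists_mem_ne_zero_of_ne_bot hker
  obtain ⟨r, hr⟩ := Function.ne_iff.1 hw0
  let v : ℕ → ℝ := fun s => if h : s < m + 1 then w ⟨s, h⟩ else 0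
  have hvr : v r ≠ 0 := by simpa [v, Fin.is_le r] using hr
  let c : ℕ → ℝ := fun s => if s = r then 0 else 1 - v s
  have hsum : (fun s => Pi.single j (c s + v s)) =
      (fun s => Pi.single j (c s)) + axisInput j (m + 1) w := by
    funext s
    exact Pi.single_add (f := fun _ : Fin d => ℝ) j (c s) (v s)
  have hstate : rnn1state U V b h0 (fun s => Pi.single j (c s + v s)) (m + 1) =
      rnn1state U V b h0 (fun s => Pi.single j (c s)) (m + 1) := by
    have h := rnn1state_add U V b h0 0 0 (fun s => Pi.single j (c s))
      (axisInput j (m + 1) w) (m + 1)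
    have h' : rnn1state U V 0 0 (axisInput j (m + 1) w) (m + 1) = 0 := hw
    rwa [h', add_zero, add_zero, add_zero, ← hsum] at h
  have heq : birnn1 A f0 (fun s => Pi.single j (c s + v s)) (m + 1) =
      birnn1 A f0 (fun s => Pi.single j (c s)) (m + 1) := by
    rw [H, H, hstate]
  have hprod : ∏ s ∈ Finset.range (m + 1), c s = 0 :=
    Finset.prod_eq_zero (Finset.mem_range.2 r.2) (by simp [c])
  have hprod' : ∏ s ∈ Finset.range (m + 1), (c s + v s) ≠ 0 :=
    Finset.prod_ne_zero_iff.2 fun s _ => by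
      by_cases h : s = r
      · simpa [c, h] using hvr
      · simp [c, h]
  rw [birnn1_single, birnn1_single, hprod, zero_smul, smul_eq_zero_iff_right hprod'] at heq
  exact hf0 (vecMul_injective_of_isUnit hdet (heq.trans (zero_vecMul _).symm))

end
end
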